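/- arXiv:1709.05040 — 2 statements merged into one kernel-verified Lean document; each statement's English description precedes it below -/
import Mathlib

section
/- Let n = 2, L = Δ (the Laplacian), ω = (a,b) for some a < b, h > 0, and Ω = (0,h) × (a,b). Let Γ₁ = {a} (so δ(x₁,x₂) = x₂ − a), let k ∈ ℕ, β ∈ [0,1/2], α₁,…,α_k ∈ [0,β], c₁,…,c_k ≥ 0, and w(x) = c₁δ^{α₁}(x) + ⋯ + c_kδ^{α_k}(x). Then there exists a constant C depending only on k and β (in particular, independent of h, a, b and u) such that every u ∈ C²(Ω) ∩ C(Ω̄) harmonic in Ω with u = 0 on (0,h)×{a,b} satisfies ‖w∇u‖²_{L²(Ω)} ≤ C( ‖wu‖_{L²(Ω)}·‖wu_{x₁}‖_{L²(Ω)}/h + ‖wu_{x₁}‖²_{L²(Ω)} ). No additional ellipticity condition relating β to eigenvalue bounds is required in this case. -/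
open MeasureTheory Set

/-- Partial derivative in the first (thin) direction of a function on `ℝ²  = ℝ × ℝ`. -/
noncomputable def d₁ (f : ℝ × ℝ → ℝ) (p : ℝ × ℝ) : ℝ := fderiv ℝ f p (1, 0)

/-- Partial derivative in the second direction. -/
noncomputable def d₂ (f : ℝ × ℝ → ℝ) (p : ℝ × ℝ) : ℝ := fderiv ℝ f p (0, 1)

/-- The Laplacian of a function on `ℝ²`. -/
noncomputable def lap (f : ℝ × ℝ → ℝ) (p : ℝ × ℝ) : ℝ :=
  fderiv ℝ (fun q => d₁ f q) p (1, 0) + fderiv ℝ (fun q => d₂ f q) p (0, 1)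

open Filter Topology

structure Cut (ε : ℝ) (G G' J : ℝ → ℝ) : Prop where
  dG : ∀ r, HasDerivAt G (G' r) r
  dJ : ∀ r, HasDerivAt J (G r) r
  cG' : Continuous G'
  nG' : ∀ r, 0 ≤ G' r
  nG : ∀ r, 0 ≤ G r
  lG : ∀ r, G r ≤ 1
  zG : ∀ r, r ≤ ε → G r = 0
  oG : ∀ r, 2 * ε ≤ r → G r = 1
  nJ : ∀ r, 0 ≤ r → 0 ≤ J r
  zJ : ∀ r, 0 ≤ r → r ≤ ε → J r = 0

lemma exists_cut (ε : ℝ) (hε : 0 < ε) : ∃ G G' J, Cut ε G G' J := by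
  have hG : ContDiff ℝ 1 (fun r : ℝ => Real.smoothTransition (r / ε - 1)) :=
    (Real.smoothTransition.contDiff (n := 1)).comp
      ((contDiff_id.div_const ε).sub contDiff_const)
  have hm : Monotone (fun r : ℝ => Real.smoothTransition (r / ε - 1)) := by
    intro r s hrs
    apply Real.smoothTransition.monotone
    gcongr
  refine ⟨fun r => Real.smoothTransition (r / ε - 1),
    deriv (fun r => Real.smoothTransition (r / ε - 1)),
    fun r => ∫ t in (0:ℝ)..r, Real.smoothTransition (t / ε - 1), ?_, ?_, ?_, ?_, ?_, ?_, ?_, ?_, ?_, ?_⟩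
  · intro r
    exact ((hG.differentiable (by norm_num)) r).hasDerivAt
  · intro r
    exact intervalIntegral.integral_hasDerivAt_right (hG.continuous.intervalIntegrable _ _)
      (hG.continuous.stronglyMeasurableAtFilter _ _) hG.continuous.continuousAt
  · exact hG.continuous_deriv le_rfl
  · intro r
    exact hm.deriv_nonneg
  · intro r
    exact Real.smoothTransition.nonneg _
  · intro r
    exact Real.smoothTransition.le_one _
  · intro r hr
    apply Real.smoothTransition.zero_of_nonpos
    rw [sub_nonpos, div_le_one hε]; exact hr
  · intro r hr
    apply Real.smoothTransition.one_of_one_le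
    have : 2 ≤ r / ε := by rw [le_div_iff₀ hε]; exact hr
    linarith
  · intro r hr
    apply intervalIntegral.integral_nonneg hr
    intro t _
    exact Real.smoothTransition.nonneg _
  · intro r hr hr'
    rw [intervalIntegral.integral_congr (g := fun _ => (0:ℝ))]
    · simp
    · intro t ht
      rw [uIcc_of_le hr] at ht
      apply Real.smoothTransition.zero_of_nonpos
      rw [sub_nonpos, div_le_one hε]; exact ht.2.trans hr'

lemma c1_facts {v : ℝ × ℝ → ℝ} {U : Set (ℝ × ℝ)} (hU : IsOpen U) (hv : ContDiffOn ℝ 2 v U) :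
    ContDiffOn ℝ 1 (d₁ v) U ∧ ContDiffOn ℝ 1 (d₂ v) U := by
  have h := hv.fderiv_of_isOpen (m := 1) hU (by norm_num)
  exact ⟨h.clm_apply contDiffOn_const, h.clm_apply contDiffOn_const⟩

structure Wt (a b : ℝ) (W W' W'' : ℝ → ℝ) : Prop where
  d : ∀ y ∈ Ioo a b, HasDerivAt W (W' y) y
  d' : ∀ y ∈ Ioo a b, HasDerivAt W' (W'' y) y
  c : ContinuousOn W'' (Ioo a b)
  n : ∀ y ∈ Ioo a b, 0 ≤ W y
  n' : ∀ y ∈ Ioo a b, W'' y ≤ 0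

lemma box_ineq {X0 X1 x0 x1 a b a' b' ε : ℝ} {v : ℝ × ℝ → ℝ} {W W' W'' φ φ' G G' J : ℝ → ℝ}
    (h0 : X0 < x0) (h01 : x0 ≤ x1) (h1 : x1 < X1) (ha : a < a') (hab : a' ≤ b') (hb : b' < b)
    (hW : Wt a b W W' W'') (hG : Cut ε G G' J)
    (hφ : ∀ x, HasDerivAt φ (φ' x) x) (hφc : Continuous φ')
    (hφ0 : φ x0 = 0) (hφ1 : φ x1 = 0) (hφn : ∀ x ∈ Icc x0 x1, 0 ≤ φ x)
    (hv : ContDiffOn ℝ 2 v (Ioo X0 X1 ×ˢ Ioo a b))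
    (hl : ∀ p ∈ Ioo X0 X1 ×ˢ Ioo a b, lap v p = 0)
    (hva : ∀ x ∈ Icc x0 x1, (v (x, a')) ^ 2 ≤ ε) (hvb : ∀ x ∈ Icc x0 x1, (v (x, b')) ^ 2 ≤ ε) :
    ∫ p in Icc x0 x1 ×ˢ Icc a' b', φ p.1 * W p.2 * G (v p ^ 2) * (d₁ v p ^ 2 + d₂ v p ^ 2) ≤
    ∫ p in Icc x0 x1 ×ˢ Icc a' b', - (φ' p.1 * W p.2 * G (v p ^ 2) * (v p * d₁ v p)) := by
  set U := Ioo X0 X1 ×ˢ Ioo a b with hUdef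
  have hU : IsOpen U := isOpen_Ioo.prod isOpen_Ioo
  set K := Icc x0 x1 ×ˢ Icc a' b' with hKdef
  have hKU : K ⊆ U := by
    rintro ⟨x, y⟩ ⟨hx, hy⟩
    exact ⟨⟨h0.trans_le hx.1, hx.2.trans_lt h1⟩, ⟨ha.trans_le hy.1, hy.2.trans_lt hb⟩⟩
  have hKc : IsCompact K := isCompact_Icc.prod isCompact_Icc
  obtain ⟨hp, hq⟩ := c1_facts hU hv
  have dv : ∀ z ∈ U, HasFDerivAt v (fderiv ℝ v z) z := fun z hz =>
    ((hv.differentiableOn (by norm_num)).differentiableAt (hU.mem_nhds hz)).hasFDerivAt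
  have dp : ∀ z ∈ U, HasFDerivAt (d₁ v) (fderiv ℝ (d₁ v) z) z := fun z hz =>
    ((hp.differentiableOn (by norm_num)).differentiableAt (hU.mem_nhds hz)).hasFDerivAt
  have dq : ∀ z ∈ U, HasFDerivAt (d₂ v) (fderiv ℝ (d₂ v) z) z := fun z hz =>
    ((hq.differentiableOn (by norm_num)).differentiableAt (hU.mem_nhds hz)).hasFDerivAt
  have dφ : ∀ z : ℝ × ℝ, HasFDerivAt (fun z : ℝ × ℝ => φ z.1) (φ' z.1 • ContinuousLinearMap.fst ℝ ℝ ℝ) z :=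
    fun z => (hφ z.1).comp_hasFDerivAt z hasFDerivAt_fst
  have dW : ∀ z ∈ U, HasFDerivAt (fun z : ℝ × ℝ => W z.2) (W' z.2 • ContinuousLinearMap.snd ℝ ℝ ℝ) z :=
    fun z hz => (hW.d z.2 hz.2).comp_hasFDerivAt z hasFDerivAt_snd
  have dW' : ∀ z ∈ U, HasFDerivAt (fun z : ℝ × ℝ => W' z.2) (W'' z.2 • ContinuousLinearMap.snd ℝ ℝ ℝ) z :=
    fun z hz => (hW.d' z.2 hz.2).comp_hasFDerivAt z hasFDerivAt_snd
  have dG : ∀ z ∈ U, HasFDerivAt (fun z : ℝ × ℝ => G (v z ^ 2)) (G' (v z ^ 2) • ((2 * v z) • fderiv ℝ v z)) z := by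
    intro z hz
    have := ((dv z hz).pow 2)
    simp only [Nat.add_one_sub_one, pow_one] at this
    exact (hG.dG (v z ^ 2)).comp_hasFDerivAt z (by convert this using 2; simp)
  have dJ : ∀ z ∈ U, HasFDerivAt (fun z : ℝ × ℝ => J (v z ^ 2)) (G (v z ^ 2) • ((2 * v z) • fderiv ℝ v z)) z := by
    intro z hz
    have := ((dv z hz).pow 2)
    simp only [Nat.add_one_sub_one, pow_one] at this
    exact (hG.dJ (v z ^ 2)).comp_hasFDerivAt z (by convert this using 2; simp)
  have dF1 := fun z hz => (((dφ z).mul (dW z hz)).mul (dG z hz)).mul ((dv z hz).mul (dp z hz))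
  have dF2 := fun z hz => (dφ z).mul ((((dW z hz).mul (dG z hz)).mul ((dv z hz).mul (dq z hz))).sub
    ((dW' z hz).mul ((dJ z hz).const_mul (1/2 : ℝ))))
  have cv : ContinuousOn v U := hv.continuousOn
  have cp : ContinuousOn (d₁ v) U := hp.continuousOn
  have cq : ContinuousOn (d₂ v) U := hq.continuousOn
  have cW : ContinuousOn (fun z : ℝ × ℝ => W z.2) U := fun z hz => (dW z hz).continuousAt.continuousWithinAt
  have cW'' : ContinuousOn (fun z : ℝ × ℝ => W'' z.2) U := hW.c.comp continuousOn_snd (fun z hz => hz.2)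
  have cφ : ContinuousOn (fun z : ℝ × ℝ => φ z.1) U := fun z hz => (dφ z).continuousAt.continuousWithinAt
  have cφ' : ContinuousOn (fun z : ℝ × ℝ => φ' z.1) U := (hφc.comp continuous_fst).continuousOn
  have cG : ContinuousOn (fun z : ℝ × ℝ => G (v z ^ 2)) U := fun z hz => (dG z hz).continuousAt.continuousWithinAt
  have cG' : ContinuousOn (fun z : ℝ × ℝ => G' (v z ^ 2)) U := hG.cG'.comp_continuousOn (cv.pow 2)
  have cJ : ContinuousOn (fun z : ℝ × ℝ => J (v z ^ 2)) U := fun z hz => (dJ z hz).continuousAt.continuousWithinAt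
  -- divergence
  let D : ℝ × ℝ → ℝ := fun z => φ' z.1 * W z.2 * G (v z ^ 2) * (v z * d₁ v z) +
    φ z.1 * W z.2 * (G (v z ^ 2) + 2 * v z ^ 2 * G' (v z ^ 2)) * (d₁ v z ^ 2 + d₂ v z ^ 2)
    - φ z.1 * W'' z.2 * (1 / 2 * J (v z ^ 2))
  have cD : ContinuousOn D U := by
    exact ((((cφ'.mul cW).mul cG).mul (cv.mul cp)).add (((cφ.mul cW).mul (cG.add
      ((continuousOn_const.mul (cv.pow 2)).mul cG'))).mul ((cp.pow 2).add (cq.pow 2)))).sub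
      ((cφ.mul cW'').mul (continuousOn_const.mul cJ))
  let F1 : ℝ × ℝ → ℝ := fun z => φ z.1 * W z.2 * G (v z ^ 2) * (v z * d₁ v z)
  let F2 : ℝ × ℝ → ℝ := fun z => φ z.1 * (W z.2 * G (v z ^ 2) * (v z * d₂ v z) - W' z.2 * (1/2 * J (v z ^ 2)))
  have hD : ∀ z ∈ U, fderiv ℝ F1 z (1, 0) + fderiv ℝ F2 z (0, 1) = D z := by
    intro z hz'
    have f1 : fderiv ℝ F1 z = _ := (dF1 z hz').fderiv
    have f2 : fderiv ℝ F2 z = _ := (dF2 z hz').fderiv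
    have hlap := hl z hz'
    have e1 : fderiv ℝ v z (1, 0) = d₁ v z := rfl
    have e2 : fderiv ℝ v z (0, 1) = d₂ v z := rfl
    have e3 : fderiv ℝ (d₁ v) z (1, 0) = - fderiv ℝ (d₂ v) z (0, 1) := by
      have : fderiv ℝ (d₁ v) z (1, 0) + fderiv ℝ (d₂ v) z (0, 1) = 0 := hlap
      linarith
    rw [f1, f2]
    simp [e1, e2, e3, D]
    ring
  have eK : Icc (x0, a') (x1, b') = K := (Icc_prod_Icc x0 x1 a' b').symm
  have key := integral_divergence_prod_Icc_of_hasFDerivAt_of_le F1 F2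
    (fderiv ℝ F1) (fderiv ℝ F2) (x0, a') (x1, b') ⟨h01, hab⟩
    (fun z hz => (dF1 z (hKU (eK ▸ hz))).continuousAt.continuousWithinAt)
    (fun z hz => (dF2 z (hKU (eK ▸ hz))).continuousAt.continuousWithinAt)
    (fun z hz => (dF1 z (hKU ⟨Ioo_subset_Icc_self hz.1, Ioo_subset_Icc_self hz.2⟩)).differentiableAt.hasFDerivAt)
    (fun z hz => (dF2 z (hKU ⟨Ioo_subset_Icc_self hz.1, Ioo_subset_Icc_self hz.2⟩)).differentiableAt.hasFDerivAt)
    (by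
      rw [eK]
      refine ((cD.mono hKU).integrableOn_compact hKc).congr_fun (fun z hz => (hD z (hKU hz)).symm) hKc.measurableSet)
  rw [eK, setIntegral_congr_fun hKc.measurableSet (fun z hz => hD z (hKU hz))] at key
  have z1 : ∫ x in x0..x1, F2 (x, b') = 0 := by
    rw [intervalIntegral.integral_congr (g := fun _ => (0:ℝ))]
    · simp
    · intro x hx
      rw [uIcc_of_le h01] at hx
      simp [F2, hG.zG _ (hvb x hx), hG.zJ _ (sq_nonneg _) (hvb x hx)]
  have z2 : ∫ x in x0..x1, F2 (x, a') = 0 := by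
    rw [intervalIntegral.integral_congr (g := fun _ => (0:ℝ))]
    · simp
    · intro x hx
      rw [uIcc_of_le h01] at hx
      simp [F2, hG.zG _ (hva x hx), hG.zJ _ (sq_nonneg _) (hva x hx)]
  have z3 : ∫ y in a'..b', F1 (x1, y) = 0 := by simp [F1, hφ1]
  have z4 : ∫ y in a'..b', F1 (x0, y) = 0 := by simp [F1, hφ0]
  simp only [z1, z2, z3, z4] at key
  have cA := ((((cφ.mul cW).mul cG).mul ((cp.pow 2).add (cq.pow 2))).mono hKU).integrableOn_compact (μ := volume) hKc
  have cB := ((((cφ'.mul cW).mul cG).mul (cv.mul cp)).neg.mono hKU).integrableOn_compact (μ := volume) hKc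
  have cDi := (cD.mono hKU).integrableOn_compact (μ := volume) hKc
  have : ∫ z in K, φ z.1 * W z.2 * G (v z ^ 2) * (d₁ v z ^ 2 + d₂ v z ^ 2) ≤
      ∫ z in K, (D z + - (φ' z.1 * W z.2 * G (v z ^ 2) * (v z * d₁ v z))) := by
    refine setIntegral_mono_on cA (cDi.add cB) hKc.measurableSet (fun z hz => ?_)
    have hz' := hKU hz
    have n1 := hφn z.1 hz.1
    have n2 := hW.n z.2 hz'.2
    have n3 := hW.n' z.2 hz'.2
    have n4 := hG.nJ (v z ^ 2) (sq_nonneg _)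
    have n5 := hG.nG' (v z ^ 2)
    have m1 : 0 ≤ φ z.1 * W z.2 * (2 * v z ^ 2 * G' (v z ^ 2)) * (d₁ v z ^ 2 + d₂ v z ^ 2) := by positivity
    have m2 : 0 ≤ φ z.1 * (- W'' z.2) * (1 / 2 * J (v z ^ 2)) := by
      have : 0 ≤ - W'' z.2 := by linarith
      positivity
    simp only [D]
    linarith
  refine this.trans (le_of_eq ((integral_add cDi cB).trans ?_))
  rw [key]
  norm_num

lemma strip_sep {x0 x1 a b ε : ℝ} {v : ℝ × ℝ → ℝ} (hε : 0 < ε) (hab : a < b)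
    (hc : ContinuousOn v (Icc x0 x1 ×ˢ Icc a b))
    (hz : ∀ x ∈ Icc x0 x1, v (x, a) = 0 ∧ v (x, b) = 0) :
    ∃ a' b', a < a' ∧ a' ≤ b' ∧ b' < b ∧
      ∀ x ∈ Icc x0 x1, ∀ y ∈ Icc a b, (y ≤ a' ∨ b' ≤ y) → v (x, y) ^ 2 ≤ ε := by
  have huc := (isCompact_Icc.prod isCompact_Icc).uniformContinuousOn_of_continuous hc
  rw [Metric.uniformContinuousOn_iff] at huc
  obtain ⟨δ, hδ, H⟩ := huc (√ε) (Real.sqrt_pos.2 hε)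
  have hm : 0 < min (δ / 2) ((b - a) / 3) := by
    apply lt_min <;> linarith
  have hm1 := min_le_left (δ / 2) ((b - a) / 3)
  have hm2 := min_le_right (δ / 2) ((b - a) / 3)
  set m := min (δ / 2) ((b - a) / 3)
  refine ⟨a + m, b - m, by linarith, by linarith, by linarith, ?_⟩
  have fin : ∀ x ∈ Icc x0 x1, ∀ y ∈ Icc a b, ∀ y' ∈ Icc a b, v (x, y') = 0 → |y - y'| ≤ m → v (x, y) ^ 2 ≤ ε := by
    intro x hx y hy y' hy' h0 hyy
    have := H (x, y) ⟨hx, hy⟩ (x, y') ⟨hx, hy'⟩ (by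
      rw [Prod.dist_eq]; simp [Real.dist_eq]; linarith)
    rw [h0, Real.dist_eq, sub_zero] at this
    calc v (x, y) ^ 2 = |v (x, y)| ^ 2 := (sq_abs _).symm
      _ ≤ √ε ^ 2 := by gcongr
      _ = ε := Real.sq_sqrt hε.le
  intro x hx y hy h
  rcases h with h | h
  · refine fin x hx y hy a ⟨le_rfl, hab.le⟩ (hz x hx).1 ?_
    rw [abs_of_nonneg (by linarith [hy.1])]; linarith
  · refine fin x hx y hy b ⟨hab.le, le_rfl⟩ (hz x hx).2 ?_
    rw [abs_of_nonpos (by linarith [hy.2])]; linarith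

lemma strip_ineq {X0 X1 x0 x1 a b ε : ℝ} {v : ℝ × ℝ → ℝ} {W W' W'' φ φ' G G' J : ℝ → ℝ}
    (hε : 0 < ε)
    (h0 : X0 < x0) (h01 : x0 ≤ x1) (h1 : x1 < X1) (hab : a < b)
    (hW : Wt a b W W' W'') (hG : Cut ε G G' J)
    (hφ : ∀ x, HasDerivAt φ (φ' x) x) (hφc : Continuous φ')
    (hφ0 : φ x0 = 0) (hφ1 : φ x1 = 0) (hφn : ∀ x ∈ Icc x0 x1, 0 ≤ φ x)
    (hv : ContDiffOn ℝ 2 v (Ioo X0 X1 ×ˢ Ioo a b))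
    (hl : ∀ p ∈ Ioo X0 X1 ×ˢ Ioo a b, lap v p = 0)
    (hc : ContinuousOn v (Icc x0 x1 ×ˢ Icc a b))
    (hz : ∀ x ∈ Icc x0 x1, v (x, a) = 0 ∧ v (x, b) = 0) :
    (∀ F : ℝ × ℝ → ℝ, ContinuousOn F (Ioo X0 X1 ×ˢ Ioo a b) →
      IntegrableOn (fun z => F z * G (v z ^ 2)) (Icc x0 x1 ×ˢ Ioo a b)) ∧
    ∫ p in Icc x0 x1 ×ˢ Ioo a b, (φ p.1 * W p.2 * (d₁ v p ^ 2 + d₂ v p ^ 2)) * G (v p ^ 2) ≤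
    ∫ p in Icc x0 x1 ×ˢ Ioo a b, - (φ' p.1 * W p.2 * (v p * d₁ v p)) * G (v p ^ 2) := by
  obtain ⟨a', b', ha, hab', hb, H⟩ := strip_sep hε hab hc hz
  have hU : IsOpen (Ioo X0 X1 ×ˢ Ioo a b) := isOpen_Ioo.prod isOpen_Ioo
  have hKS : Icc x0 x1 ×ˢ Icc a' b' ⊆ Icc x0 x1 ×ˢ Ioo a b := by
    rintro ⟨x, y⟩ ⟨hx, hy⟩
    exact ⟨hx, ⟨ha.trans_le hy.1, hy.2.trans_lt hb⟩⟩
  have hSU : Icc x0 x1 ×ˢ Ioo a b ⊆ Ioo X0 X1 ×ˢ Ioo a b := by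
    rintro ⟨x, y⟩ ⟨hx, hy⟩
    exact ⟨⟨h0.trans_le hx.1, hx.2.trans_lt h1⟩, hy⟩
  have hKc : IsCompact (Icc x0 x1 ×ˢ Icc a' b') := isCompact_Icc.prod isCompact_Icc
  have hS : MeasurableSet (Icc x0 x1 ×ˢ Ioo a b) := measurableSet_Icc.prod measurableSet_Ioo
  have hzero : ∀ z ∈ (Icc x0 x1 ×ˢ Ioo a b) \ (Icc x0 x1 ×ˢ Icc a' b'), G (v z ^ 2) = 0 := by
    rintro ⟨x, y⟩ ⟨⟨hx, hy⟩, hn⟩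
    apply hG.zG
    apply H x hx y (Ioo_subset_Icc_self hy)
    by_contra hcon
    push Not at hcon
    exact hn ⟨hx, hcon.1.le, hcon.2.le⟩
  have hGc : Continuous G := continuous_iff_continuousAt.2 fun r => (hG.dG r).continuousAt
  refine ⟨?_, ?_⟩
  · intro F hF
    have : IntegrableOn (fun z => F z * G (v z ^ 2)) (Icc x0 x1 ×ˢ Icc a' b') :=
      ((hF.mul (hGc.comp_continuousOn (hv.continuousOn.pow 2))).mono
        (hKS.trans hSU)).integrableOn_compact hKc
    refine this.of_forall_sdiff_eq_zero hS (fun z hz => ?_)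
    rw [hzero z hz, mul_zero]
  · rw [setIntegral_eq_of_subset_of_forall_sdiff_eq_zero hS hKS (fun z hz => by rw [hzero z hz, mul_zero]),
      setIntegral_eq_of_subset_of_forall_sdiff_eq_zero hS hKS (fun z hz => by rw [hzero z hz, mul_zero])]
    have := box_ineq h0 h01 h1 ha hab' hb hW hG hφ hφc hφ0 hφ1 hφn hv hl
      (fun x hx => H x hx a' ⟨ha.le, (hab'.trans hb.le)⟩ (Or.inl le_rfl))
      (fun x hx => H x hx b' ⟨(ha.le.trans hab'), hb.le⟩ (Or.inr le_rfl))
    refine le_trans (le_of_eq ?_) (this.trans (le_of_eq ?_)) <;>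
    exact setIntegral_congr_fun hKc.measurableSet (fun z _ => by ring)

/-- a.e. vanishing of the derivative on the zero set -/
lemma countable_zero {f f' : ℝ → ℝ} {s : Set ℝ} (hf : ∀ y ∈ s, HasDerivAt f (f' y) y) :
    {y | y ∈ s ∧ f y = 0 ∧ f' y ≠ 0}.Countable := by
  set T := {y | y ∈ s ∧ f y = 0 ∧ f' y ≠ 0}
  have : DiscreteTopology T := by
    rw [discreteTopology_subtype_iff]
    rintro y ⟨hy, h0, h1⟩
    have := (hf y hy).eventually_ne (c := 0) h1
    rw [← disjoint_iff, disjoint_principal_right]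
    filter_upwards [this] with z hz hzT
    exact hz hzT.2.1
  exact (TopologicalSpace.separableSpace_iff_countable.1 inferInstance : Countable T).to_set

lemma ae_zero {f g : ℝ × ℝ → ℝ} {U : Set (ℝ × ℝ)} (hU : IsOpen U)
    (hf : ContinuousOn f U) (hg : ContinuousOn g U)
    (hd : ∀ z ∈ U, HasDerivAt (fun y => f (z.1, y)) (g z) z.2) :
    ∀ᵐ z ∂(volume : Measure (ℝ × ℝ)), z ∈ U → f z = 0 → g z = 0 := by
  have hm : MeasurableSet {z | z ∈ U ∧ f z = 0 ∧ g z ≠ 0} := by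
    have h1 : MeasurableSet (U ∩ f ⁻¹' {0}) := by
      obtain ⟨t, ht, e⟩ := (continuousOn_iff_isClosed.1 hf) {0} isClosed_singleton
      rw [inter_comm, e]; exact ht.measurableSet.inter hU.measurableSet
    have h2 : MeasurableSet (U ∩ g ⁻¹' {0}ᶜ) :=
      (hg.isOpen_inter_preimage hU isOpen_compl_singleton).measurableSet
    convert h1.inter h2 using 1
    ext z; simp
  have : (volume : Measure (ℝ × ℝ)) {z | z ∈ U ∧ f z = 0 ∧ g z ≠ 0} = 0 := by
    rw [Measure.volume_eq_prod, Measure.measure_prod_null hm]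
    refine Eventually.of_forall (fun x => ?_)
    have := countable_zero (f := fun y => f (x, y)) (f' := fun y => g (x, y)) (s := {y | (x, y) ∈ U})
      (fun y hy => hd (x, y) hy)
    exact this.measure_zero _
  rw [← compl_mem_ae_iff] at this
  filter_upwards [this] with z hz hzU h0
  by_contra hne
  exact hz ⟨hzU, h0, hne⟩

lemma fatou_bound {X : Type*} [MeasurableSpace X] {μ : Measure X} {f : ℕ → X → ENNReal} {g : X → ENNReal}
    {C : ENNReal} (hf : ∀ n, AEMeasurable (f n) μ) (hC : ∀ n, ∫⁻ x, f n x ∂μ ≤ C)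
    (hl : ∀ᵐ x ∂μ, Tendsto (fun n => f n x) atTop (𝓝 (g x))) : ∫⁻ x, g x ∂μ ≤ C := by
  calc ∫⁻ x, g x ∂μ = ∫⁻ x, liminf (fun n => f n x) atTop ∂μ := by
        refine lintegral_congr_ae ?_
        filter_upwards [hl] with x hx using hx.liminf_eq.symm
    _ ≤ liminf (fun n => ∫⁻ x, f n x ∂μ) atTop := lintegral_liminf_le' hf
    _ ≤ liminf (fun _ : ℕ => C) atTop := liminf_le_liminf (Eventually.of_forall hC)
    _ = C := by simp

lemma est2a {X0 X1 x0 x1 a b ε : ℝ} {v : ℝ × ℝ → ℝ} {W W' W'' φ φ' G G' J : ℝ → ℝ}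
    (hε : 0 < ε)
    (h0 : X0 < x0) (h01 : x0 ≤ x1) (h1 : x1 < X1) (hab : a < b)
    (hW : Wt a b W W' W'') (hG : Cut ε G G' J)
    (hφ : ∀ x, HasDerivAt φ (φ' x) x) (hφc : Continuous φ')
    (hφ0 : φ x0 = 0) (hφ1 : φ x1 = 0)
    (hφb : ∀ x ∈ Icc x0 x1, |φ' x| ≤ 1)
    (hv : ContDiffOn ℝ 2 v (Ioo X0 X1 ×ˢ Ioo a b))
    (hl : ∀ p ∈ Ioo X0 X1 ×ˢ Ioo a b, lap v p = 0)
    (hc : ContinuousOn v (Icc x0 x1 ×ˢ Icc a b))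
    (hz : ∀ x ∈ Icc x0 x1, v (x, a) = 0 ∧ v (x, b) = 0) :
    ∫⁻ p in Icc x0 x1 ×ˢ Ioo a b, ENNReal.ofReal (φ p.1 ^ 2 * W p.2 * d₂ v p ^ 2 * G (v p ^ 2)) ≤
    ∫⁻ p in Icc x0 x1 ×ˢ Ioo a b, ENNReal.ofReal (W p.2 * v p ^ 2) := by
  have hS : MeasurableSet (Icc x0 x1 ×ˢ Ioo a b) := measurableSet_Icc.prod measurableSet_Ioo
  have hU : IsOpen (Ioo X0 X1 ×ˢ Ioo a b) := isOpen_Ioo.prod isOpen_Ioo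
  have hφcc : Continuous φ := continuous_iff_continuousAt.2 fun r => (hφ r).continuousAt
  obtain ⟨hI, hin⟩ := strip_ineq (φ := fun x => φ x ^ 2) (φ' := fun x => 2 * φ x * φ' x) hε h0 h01 h1 hab hW hG
    (fun x => by have := (hφ x).pow 2; simp at this; exact this) (by fun_prop) (by simp [hφ0]) (by simp [hφ1])
    (fun x _ => sq_nonneg _) hv hl hc hz
  obtain ⟨hp, hq⟩ := c1_facts hU hv
  have cv := hv.continuousOn
  have cp := hp.continuousOn
  have cq := hq.continuousOn
  have cW : ContinuousOn (fun z : ℝ × ℝ => W z.2) (Ioo X0 X1 ×ˢ Ioo a b) := fun z hz =>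
    ((hW.d z.2 hz.2).continuousAt.comp continuous_snd.continuousAt).continuousWithinAt
  have cφ : ContinuousOn (fun z : ℝ × ℝ => φ z.1) (Ioo X0 X1 ×ˢ Ioo a b) := by fun_prop
  have cφ' : ContinuousOn (fun z : ℝ × ℝ => φ' z.1) (Ioo X0 X1 ×ˢ Ioo a b) := by fun_prop
  have I1 := hI (fun z => φ z.1 ^ 2 * W z.2 * d₂ v z ^ 2) (((cφ.pow 2).mul cW).mul (cq.pow 2))
  have I2 := hI (fun z => φ z.1 ^ 2 * W z.2 * d₁ v z ^ 2) (((cφ.pow 2).mul cW).mul (cp.pow 2))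
  have I3 := hI (fun z => φ' z.1 ^ 2 * W z.2 * v z ^ 2) (((cφ'.pow 2).mul cW).mul (cv.pow 2))
  have I4 := hI (fun z => - (2 * φ z.1 * φ' z.1 * W z.2 * (v z * d₁ v z)))
    ((((continuousOn_const.mul cφ).mul cφ').mul cW).mul (cv.mul cp)).neg
  have e1 : ∫ p in Icc x0 x1 ×ˢ Ioo a b, (φ p.1 ^ 2 * W p.2 * (d₁ v p ^ 2 + d₂ v p ^ 2)) * G (v p ^ 2)
     = (∫ p in Icc x0 x1 ×ˢ Ioo a b, φ p.1 ^ 2 * W p.2 * d₂ v p ^ 2 * G (v p ^ 2)) +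
       ∫ p in Icc x0 x1 ×ˢ Ioo a b, φ p.1 ^ 2 * W p.2 * d₁ v p ^ 2 * G (v p ^ 2) := by
    rw [← integral_add I1 I2]
    exact setIntegral_congr_fun hS (fun z _ => by ring)
  have e2 : ∫ p in Icc x0 x1 ×ˢ Ioo a b, - (2 * φ p.1 * φ' p.1 * W p.2 * (v p * d₁ v p)) * G (v p ^ 2)
     ≤ (∫ p in Icc x0 x1 ×ˢ Ioo a b, φ' p.1 ^ 2 * W p.2 * v p ^ 2 * G (v p ^ 2)) +
       ∫ p in Icc x0 x1 ×ˢ Ioo a b, φ p.1 ^ 2 * W p.2 * d₁ v p ^ 2 * G (v p ^ 2) := by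
    rw [← integral_add I3 I2]
    refine setIntegral_mono_on I4 (I3.add I2) hS (fun z hz => ?_)
    have n1 := hW.n z.2 hz.2
    have n2 := hG.nG (v z ^ 2)
    have : 0 ≤ W z.2 * G (v z ^ 2) * (φ' z.1 * v z + φ z.1 * d₁ v z) ^ 2 := by positivity
    nlinarith [this]
  have e3 : (∫ p in Icc x0 x1 ×ˢ Ioo a b, φ p.1 ^ 2 * W p.2 * d₂ v p ^ 2 * G (v p ^ 2)) ≤
      ∫ p in Icc x0 x1 ×ˢ Ioo a b, φ' p.1 ^ 2 * W p.2 * v p ^ 2 * G (v p ^ 2) := by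
    have := hin.trans e2
    rw [e1] at this
    linarith
  rw [← ofReal_integral_eq_lintegral_ofReal I1]
  · refine (ENNReal.ofReal_le_ofReal e3).trans ?_
    rw [ofReal_integral_eq_lintegral_ofReal I3]
    · refine setLIntegral_mono' hS (fun z hz => ENNReal.ofReal_le_ofReal ?_)
      have n1 := hW.n z.2 hz.2
      have n2 := hG.nG (v z ^ 2)
      have n3 := hG.lG (v z ^ 2)
      have n4 : φ' z.1 ^ 2 ≤ 1 := by
        rw [sq_le_one_iff_abs_le_one]; exact hφb _ hz.1
      have n5 : 0 ≤ W z.2 * v z ^ 2 := by positivity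
      calc φ' z.1 ^ 2 * W z.2 * v z ^ 2 * G (v z ^ 2) = (φ' z.1 ^ 2 * G (v z ^ 2)) * (W z.2 * v z ^ 2) := by ring
        _ ≤ (1 * 1) * (W z.2 * v z ^ 2) := by gcongr
        _ = _ := by ring
    · refine (ae_restrict_iff' hS).2 (Eventually.of_forall fun z hz => ?_)
      have n1 := hW.n z.2 hz.2
      have n2 := hG.nG (v z ^ 2)
      simp only [Pi.zero_apply]
      positivity
  · refine (ae_restrict_iff' hS).2 (Eventually.of_forall fun z hz => ?_)
    have n1 := hW.n z.2 hz.2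
    have n2 := hG.nG (v z ^ 2)
    simp only [Pi.zero_apply]
    positivity

lemma est1a {X0 X1 x0 x1 a b ε : ℝ} {v : ℝ × ℝ → ℝ} {W W' W'' φ φ' G G' J : ℝ → ℝ}
    (hε : 0 < ε)
    (h0 : X0 < x0) (h01 : x0 ≤ x1) (h1 : x1 < X1) (hab : a < b)
    (hW : Wt a b W W' W'') (hG : Cut ε G G' J)
    (hφ : ∀ x, HasDerivAt φ (φ' x) x) (hφc : Continuous φ')
    (hφ0 : φ x0 = 0) (hφ1 : φ x1 = 0) (hφn : ∀ x ∈ Icc x0 x1, 0 ≤ φ x)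
    (hφb : ∀ x ∈ Icc x0 x1, |φ' x| ≤ 1)
    (hv : ContDiffOn ℝ 2 v (Ioo X0 X1 ×ˢ Ioo a b))
    (hl : ∀ p ∈ Ioo X0 X1 ×ˢ Ioo a b, lap v p = 0)
    (hc : ContinuousOn v (Icc x0 x1 ×ˢ Icc a b))
    (hz : ∀ x ∈ Icc x0 x1, v (x, a) = 0 ∧ v (x, b) = 0)
    (hA : IntegrableOn (fun p => W p.2 * |v p * d₁ v p|) (Ioo X0 X1 ×ˢ Ioo a b)) :
    ∫⁻ p in Icc x0 x1 ×ˢ Ioo a b, ENNReal.ofReal (φ p.1 * W p.2 * d₂ v p ^ 2 * G (v p ^ 2)) ≤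
    ENNReal.ofReal (∫ p in Ioo X0 X1 ×ˢ Ioo a b, W p.2 * |v p * d₁ v p|) := by
  have hS : MeasurableSet (Icc x0 x1 ×ˢ Ioo a b) := measurableSet_Icc.prod measurableSet_Ioo
  have hU : IsOpen (Ioo X0 X1 ×ˢ Ioo a b) := isOpen_Ioo.prod isOpen_Ioo
  have hSU : Icc x0 x1 ×ˢ Ioo a b ⊆ Ioo X0 X1 ×ˢ Ioo a b := by
    rintro ⟨x, y⟩ ⟨hx, hy⟩
    exact ⟨⟨h0.trans_le hx.1, hx.2.trans_lt h1⟩, hy⟩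
  have hφcc : Continuous φ := continuous_iff_continuousAt.2 fun r => (hφ r).continuousAt
  obtain ⟨hI, hin⟩ := strip_ineq hε h0 h01 h1 hab hW hG hφ hφc hφ0 hφ1 hφn hv hl hc hz
  obtain ⟨hp, hq⟩ := c1_facts hU hv
  have cv := hv.continuousOn
  have cp := hp.continuousOn
  have cq := hq.continuousOn
  have cW : ContinuousOn (fun z : ℝ × ℝ => W z.2) (Ioo X0 X1 ×ˢ Ioo a b) := fun z hz =>
    ((hW.d z.2 hz.2).continuousAt.comp continuous_snd.continuousAt).continuousWithinAt
  have cφ : ContinuousOn (fun z : ℝ × ℝ => φ z.1) (Ioo X0 X1 ×ˢ Ioo a b) := by fun_prop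
  have cφ' : ContinuousOn (fun z : ℝ × ℝ => φ' z.1) (Ioo X0 X1 ×ˢ Ioo a b) := by fun_prop
  have I1 := hI (fun z => φ z.1 * W z.2 * d₂ v z ^ 2) (((cφ).mul cW).mul (cq.pow 2))
  have I2 := hI (fun z => φ z.1 * W z.2 * (d₁ v z ^ 2 + d₂ v z ^ 2)) (((cφ).mul cW).mul ((cp.pow 2).add (cq.pow 2)))
  have I4 := hI (fun z => - (φ' z.1 * W z.2 * (v z * d₁ v z)))
    (((cφ').mul cW).mul (cv.mul cp)).neg
  have e1 : ∫ p in Icc x0 x1 ×ˢ Ioo a b, φ p.1 * W p.2 * d₂ v p ^ 2 * G (v p ^ 2)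
     ≤ ∫ p in Icc x0 x1 ×ˢ Ioo a b, φ p.1 * W p.2 * (d₁ v p ^ 2 + d₂ v p ^ 2) * G (v p ^ 2) := by
    refine setIntegral_mono_on I1 I2 hS (fun z hz => ?_)
    have n1 := hW.n z.2 hz.2
    have n2 := hG.nG (v z ^ 2)
    have n3 := hφn z.1 hz.1
    have : 0 ≤ φ z.1 * W z.2 * d₁ v z ^ 2 * G (v z ^ 2) := by positivity
    nlinarith [this]
  have e2 : ∫ p in Icc x0 x1 ×ˢ Ioo a b, - (φ' p.1 * W p.2 * (v p * d₁ v p)) * G (v p ^ 2)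
     ≤ ∫ p in Icc x0 x1 ×ˢ Ioo a b, W p.2 * |v p * d₁ v p| := by
    refine setIntegral_mono_on I4 (hA.mono_set hSU) hS (fun z hz => ?_)
    have n1 := hW.n z.2 hz.2
    have n2 := hG.nG (v z ^ 2)
    have n3 := hG.lG (v z ^ 2)
    have n4 := hφb _ hz.1
    calc - (φ' z.1 * W z.2 * (v z * d₁ v z)) * G (v z ^ 2) ≤ |- (φ' z.1 * W z.2 * (v z * d₁ v z)) * G (v z ^ 2)| := le_abs_self _
      _ = |φ' z.1| * G (v z ^ 2) * (W z.2 * |v z * d₁ v z|) := by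
        rw [abs_mul, abs_neg, abs_mul, abs_mul, abs_of_nonneg n1, abs_of_nonneg n2]; ring
      _ ≤ 1 * 1 * (W z.2 * |v z * d₁ v z|) := by gcongr
      _ = _ := by ring
  have e3 : ∫ p in Icc x0 x1 ×ˢ Ioo a b, W p.2 * |v p * d₁ v p| ≤
      ∫ p in Ioo X0 X1 ×ˢ Ioo a b, W p.2 * |v p * d₁ v p| := by
    refine setIntegral_mono_set hA ?_ (Eventually.of_forall hSU)
    refine (ae_restrict_iff' hU.measurableSet).2 (Eventually.of_forall fun z hz => ?_)
    have n1 := hW.n z.2 hz.2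
    simp only [Pi.zero_apply]
    positivity
  rw [← ofReal_integral_eq_lintegral_ofReal I1]
  · exact ENNReal.ofReal_le_ofReal (e1.trans (hin.trans (e2.trans e3)))
  · refine (ae_restrict_iff' hS).2 (Eventually.of_forall fun z hz => ?_)
    have n1 := hW.n z.2 hz.2
    have n2 := hG.nG (v z ^ 2)
    have n3 := hφn z.1 hz.1
    simp only [Pi.zero_apply]
    positivity

lemma slice2 {f : ℝ × ℝ → ℝ} {z : ℝ × ℝ} (h : DifferentiableAt ℝ f z) :
    HasDerivAt (fun y => f (z.1, y)) (fderiv ℝ f z (0, 1)) z.2 := by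
  have h1 : HasDerivAt (fun y : ℝ => (z.1, y)) ((0 : ℝ), (1 : ℝ)) z.2 :=
    (hasDerivAt_const _ _).prodMk (hasDerivAt_id _)
  exact h.hasFDerivAt.comp_hasDerivAt z.2 h1

lemma slice1 {f : ℝ × ℝ → ℝ} {z : ℝ × ℝ} (h : DifferentiableAt ℝ f z) :
    HasDerivAt (fun x => f (x, z.2)) (fderiv ℝ f z (1, 0)) z.1 := by
  have h1 : HasDerivAt (fun x : ℝ => (x, z.2)) ((1 : ℝ), (0 : ℝ)) z.1 :=
    (hasDerivAt_id _).prodMk (hasDerivAt_const _ _)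
  exact h.hasFDerivAt.comp_hasDerivAt z.1 h1

lemma est1 {X0 X1 x0 x1 a b : ℝ} {v : ℝ × ℝ → ℝ} {W W' W'' φ φ' : ℝ → ℝ}
    (h0 : X0 < x0) (h01 : x0 ≤ x1) (h1 : x1 < X1) (hab : a < b)
    (hW : Wt a b W W' W'')
    (hφ : ∀ x, HasDerivAt φ (φ' x) x) (hφc : Continuous φ')
    (hφ0 : φ x0 = 0) (hφ1 : φ x1 = 0) (hφn : ∀ x ∈ Icc x0 x1, 0 ≤ φ x)
    (hφb : ∀ x ∈ Icc x0 x1, |φ' x| ≤ 1)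
    (hv : ContDiffOn ℝ 2 v (Ioo X0 X1 ×ˢ Ioo a b))
    (hl : ∀ p ∈ Ioo X0 X1 ×ˢ Ioo a b, lap v p = 0)
    (hc : ContinuousOn v (Icc x0 x1 ×ˢ Icc a b))
    (hz : ∀ x ∈ Icc x0 x1, v (x, a) = 0 ∧ v (x, b) = 0)
    (hA : IntegrableOn (fun p => W p.2 * |v p * d₁ v p|) (Ioo X0 X1 ×ˢ Ioo a b)) :
    ∫⁻ p in Icc x0 x1 ×ˢ Ioo a b, ENNReal.ofReal (φ p.1 * W p.2 * d₂ v p ^ 2) ≤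
    ENNReal.ofReal (∫ p in Ioo X0 X1 ×ˢ Ioo a b, W p.2 * |v p * d₁ v p|) := by
  have hS : MeasurableSet (Icc x0 x1 ×ˢ Ioo a b) := measurableSet_Icc.prod measurableSet_Ioo
  have hU : IsOpen (Ioo X0 X1 ×ˢ Ioo a b) := isOpen_Ioo.prod isOpen_Ioo
  have hSU : Icc x0 x1 ×ˢ Ioo a b ⊆ Ioo X0 X1 ×ˢ Ioo a b := by
    rintro ⟨x, y⟩ ⟨hx, hy⟩
    exact ⟨⟨h0.trans_le hx.1, hx.2.trans_lt h1⟩, hy⟩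
  obtain ⟨hp, hq⟩ := c1_facts hU hv
  have cv := hv.continuousOn
  have cq := hq.continuousOn
  have hφcc : Continuous φ := continuous_iff_continuousAt.2 fun r => (hφ r).continuousAt
  have cW : ContinuousOn (fun z : ℝ × ℝ => W z.2) (Ioo X0 X1 ×ˢ Ioo a b) := fun z hz =>
    ((hW.d z.2 hz.2).continuousAt.comp continuous_snd.continuousAt).continuousWithinAt
  have cφ : ContinuousOn (fun z : ℝ × ℝ => φ z.1) (Ioo X0 X1 ×ˢ Ioo a b) := by fun_prop
  have hpos : ∀ n : ℕ, (0:ℝ) < 1 / ((n:ℝ) + 1) := fun n => by positivity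
  choose G G' J hG using fun n : ℕ => exists_cut (1 / ((n:ℝ) + 1)) (hpos n)
  have hGc : ∀ n, Continuous (G n) := fun n =>
    continuous_iff_continuousAt.2 fun r => ((hG n).dG r).continuousAt
  refine fatou_bound (f := fun n p => ENNReal.ofReal (φ p.1 * W p.2 * d₂ v p ^ 2 * G n (v p ^ 2))) ?_
    (fun n => est1a (hpos n) h0 h01 h1 hab hW (hG n) hφ hφc hφ0 hφ1 hφn hφb hv hl hc hz hA) ?_
  · intro n
    exact ((((cφ.mul cW).mul (cq.pow 2)).mul ((hGc n).comp_continuousOn (cv.pow 2))).mono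
      hSU).aemeasurable hS |>.ennreal_ofReal
  · have hae := ae_zero hU cv cq (fun z hz =>
      slice2 ((hv.differentiableOn (by norm_num)).differentiableAt (hU.mem_nhds hz)))
    refine (ae_restrict_iff' hS).2 ?_
    filter_upwards [hae] with z hz' hzS
    by_cases hvz : v z = 0
    · have := hz' (hSU hzS) hvz
      simp [this]
    · have hp2 : 0 < v z ^ 2 := by positivity
      have ht : Tendsto (fun n : ℕ => 2 * (1 / ((n:ℝ) + 1))) atTop (𝓝 (2 * 0)) :=
        tendsto_one_div_add_atTop_nhds_zero_nat.const_mul 2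
      rw [mul_zero] at ht
      refine tendsto_const_nhds.congr' ?_
      filter_upwards [ht.eventually_lt_const hp2] with n hn
      rw [(hG n).oG _ hn.le, mul_one]

lemma cs_mean {g : ℝ → ℝ} {x t : ℝ} (ht : 0 < t) (hg : ContinuousOn g (Icc x (x + t))) :
    ((∫ y in x..(x+t), g y) / t) ^ 2 ≤ 1 / t * ∫ y in x..(x+t), g y ^ 2 := by
  set m := (∫ y in x..(x+t), g y) / t with hm
  have hi : IntervalIntegrable g volume x (x + t) := hg.intervalIntegrable_of_Icc (by linarith)
  have hi2 : IntervalIntegrable (fun y => g y ^ 2) volume x (x + t) :=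
    (hg.pow 2).intervalIntegrable_of_Icc (by linarith)
  have h0 : 0 ≤ ∫ y in x..(x+t), (g y - m) ^ 2 :=
    intervalIntegral.integral_nonneg (by linarith) (fun y _ => sq_nonneg _)
  have e : ∫ y in x..(x+t), (g y - m) ^ 2 = (∫ y in x..(x+t), g y ^ 2) - (2 * m) * (∫ y in x..(x+t), g y) + t * m ^ 2 := by
    have : (fun y => (g y - m) ^ 2) = fun y => (g y ^ 2 - (2 * m) * g y) + m ^ 2 := by
      ext y; ring
    rw [this, intervalIntegral.integral_add (hi2.sub (hi.const_mul _)) intervalIntegrable_const,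
      intervalIntegral.integral_sub hi2 (hi.const_mul _), intervalIntegral.integral_const_mul]
    simp
  have e2 : (∫ y in x..(x+t), g y) = m * t := by rw [hm]; field_simp
  rw [e, e2] at h0
  have : t * m ^ 2 ≤ ∫ y in x..(x+t), g y ^ 2 := by nlinarith
  rw [one_div, inv_mul_eq_div, le_div_iff₀ ht]
  linarith

lemma jensen1 {f g : ℝ → ℝ} {h s t : ℝ} (hs : 0 < s) (ht : 0 < t) (hts : t < s)
    (hf : ∀ x ∈ Ioo 0 h, HasDerivAt f (g x) x) (hg : ContinuousOn g (Ioo 0 h)) :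
    ∫⁻ x in Icc s (h - s), ENNReal.ofReal (((f (x + t) - f x) / t) ^ 2) ≤
      ∫⁻ x in Ioo 0 h, ENNReal.ofReal (g x ^ 2) := by
  let k : ℝ → ENNReal := (Ioo 0 h).indicator (fun x => ENNReal.ofReal (g x ^ 2))
  have hk : Measurable k := by
    classical
    have hc : ContinuousOn (fun x => ENNReal.ofReal (g x ^ 2)) (Ioo 0 h) :=
      ENNReal.continuous_ofReal.comp_continuousOn (hg.pow 2)
    have := ContinuousOn.measurable_piecewise hc (continuousOn_const (c := (0 : ENNReal)) (s := (Ioo 0 h)ᶜ)) measurableSet_Ioo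
    convert this using 1
    exact (Set.piecewise_eq_indicator).symm
  have hke : ∫⁻ x, k x = ∫⁻ x in Ioo 0 h, ENNReal.ofReal (g x ^ 2) := lintegral_indicator measurableSet_Ioo _
  have hpt : ∀ x ∈ Icc s (h - s), ENNReal.ofReal (((f (x + t) - f x) / t) ^ 2) ≤
      ENNReal.ofReal (1 / t) * ∫⁻ τ in Ioc 0 t, k (x + τ) := by
    intro x hx
    have hsub : Icc x (x + t) ⊆ Ioo 0 h := fun y hy => ⟨by linarith [hx.1, hy.1], by linarith [hx.2, hy.2]⟩
    have hgc := hg.mono hsub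
    have hftc : ∫ y in x..(x+t), g y = f (x + t) - f x := by
      apply intervalIntegral.integral_eq_sub_of_hasDerivAt
      · intro y hy
        rw [uIcc_of_le (by linarith)] at hy
        exact hf y (hsub hy)
      · exact hgc.intervalIntegrable_of_Icc (by linarith)
    have := cs_mean ht hgc
    rw [hftc] at this
    refine (ENNReal.ofReal_le_ofReal this).trans ?_
    rw [ENNReal.ofReal_mul (by positivity)]
    gcongr
    have e1 : ∫ y in x..(x+t), g y ^ 2 = ∫ τ in (0:ℝ)..t, g (x + τ) ^ 2 := by
      have := intervalIntegral.integral_comp_add_left (a := 0) (b := t) (fun y => g y ^ 2) x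
      simp only [add_zero] at this
      exact this.symm
    have hc2 : ContinuousOn (fun τ => g (x + τ) ^ 2) (Icc 0 t) :=
      (hgc.comp (by fun_prop) (fun τ hτ => ⟨by linarith [hτ.1], by linarith [hτ.2]⟩)).pow 2
    rw [e1, intervalIntegral.integral_of_le ht.le, ofReal_integral_eq_lintegral_ofReal]
    · refine le_of_eq (setLIntegral_congr_fun measurableSet_Ioc (fun τ hτ => ?_))
      have : x + τ ∈ Ioo 0 h := hsub ⟨by linarith [hτ.1], by linarith [hτ.2]⟩
      simp only [k, indicator_of_mem this]
    · exact (hc2.integrableOn_Icc).mono_set Ioc_subset_Icc_self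
    · exact Eventually.of_forall (fun _ => sq_nonneg _)
  calc ∫⁻ x in Icc s (h - s), ENNReal.ofReal (((f (x + t) - f x) / t) ^ 2)
      ≤ ∫⁻ x in Icc s (h - s), ENNReal.ofReal (1 / t) * ∫⁻ τ in Ioc 0 t, k (x + τ) :=
        setLIntegral_mono' measurableSet_Icc hpt
    _ ≤ ∫⁻ x, ENNReal.ofReal (1 / t) * ∫⁻ τ in Ioc 0 t, k (x + τ) := setLIntegral_le_lintegral _ _
    _ = ENNReal.ofReal (1 / t) * ∫⁻ x, ∫⁻ τ in Ioc 0 t, k (x + τ) :=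
        lintegral_const_mul' _ _ ENNReal.ofReal_ne_top
    _ = ENNReal.ofReal (1 / t) * ∫⁻ τ in Ioc 0 t, ∫⁻ x, k (x + τ) := by
        rw [lintegral_lintegral_swap]
        exact (hk.comp (measurable_fst.add measurable_snd)).aemeasurable
    _ = ENNReal.ofReal (1 / t) * ∫⁻ τ in Ioc 0 t, ∫⁻ x, k x := by
        congr 1
        refine lintegral_congr (fun τ => lintegral_add_right_eq_self k τ)
    _ = ∫⁻ x, k x := by
        rw [setLIntegral_const, Real.volume_Ioc, sub_zero, mul_comm (∫⁻ x, k x), ← mul_assoc,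
          ← ENNReal.ofReal_mul (by positivity), one_div, inv_mul_cancel₀ ht.ne']
        simp
    _ = _ := hke

lemma hardy1 {f f' : ℝ → ℝ} {x0 x1 : ℝ} (h01 : x0 < x1)
    (hf : ∀ x ∈ Icc x0 x1, HasDerivAt f (f' x) x) (hf' : ContinuousOn f' (Icc x0 x1)) :
    ∫⁻ x in Icc x0 x1, ENNReal.ofReal (f x ^ 2) ≤
      ENNReal.ofReal (12 / (x1 - x0)) *
        (∫⁻ x in Icc x0 x1, ENNReal.ofReal ((x - x0) * (x1 - x) / (x1 - x0) * f x ^ 2)) +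
      4 * ∫⁻ x in Icc x0 x1, ENNReal.ofReal (((x - x0) * (x1 - x) / (x1 - x0)) ^ 2 * f' x ^ 2) := by
  set l := x1 - x0 with hl
  have hlp : 0 < l := by simp [hl, h01]
  have hfc : ContinuousOn f (Icc x0 x1) := fun x hx => (hf x hx).continuousAt.continuousWithinAt
  have c1 : ContinuousOn (fun x => f x ^ 2) (Icc x0 x1) := hfc.pow 2
  have cφ : ContinuousOn (fun x : ℝ => (x - x0) * (x1 - x) / l) (Icc x0 x1) := by fun_prop
  have cg : ContinuousOn (fun x : ℝ => (x0 + x1 - 2 * x) / l) (Icc x0 x1) := by fun_prop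
  have c2 : ContinuousOn (fun x => (x - x0) * (x1 - x) / l * f x ^ 2) (Icc x0 x1) := cφ.mul c1
  have c3 : ContinuousOn (fun x => ((x - x0) * (x1 - x) / l) ^ 2 * f' x ^ 2) (Icc x0 x1) := (cφ.pow 2).mul (hf'.pow 2)
  let P' : ℝ → ℝ := fun x => (1 - 6 / l * ((x - x0) * (x1 - x) / l)) * f x ^ 2 +
    2 * ((x - x0) * (x1 - x) / l) * ((x0 + x1 - 2 * x) / l) * (f x * f' x)
  have c4 : ContinuousOn P' (Icc x0 x1) :=
    ((continuousOn_const.sub (continuousOn_const.mul cφ)).mul c1).add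
      (((continuousOn_const.mul cφ).mul cg).mul (hfc.mul hf'))
  have hftc : ∫ x in x0..x1, P' x = 0 := by
    rw [intervalIntegral.integral_eq_sub_of_hasDerivAt (f := fun x => (x - x0) * (x1 - x) / l * ((x0 + x1 - 2 * x) / l) * f x ^ 2)]
    · simp
    · intro x hx
      rw [uIcc_of_le h01.le] at hx
      have d1 : HasDerivAt (fun x : ℝ => (x - x0) * (x1 - x) / l) ((x0 + x1 - 2 * x) / l) x := by
        have := (((hasDerivAt_id x).sub_const x0).mul ((hasDerivAt_id x).const_sub x1)).div_const l
        exact this.congr_deriv (by simp; ring)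
      have d2 : HasDerivAt (fun x : ℝ => (x0 + x1 - 2 * x) / l) (- 2 / l) x := by
        have := (((hasDerivAt_id x).const_mul 2).const_sub (x0 + x1)).div_const l
        exact this.congr_deriv (by simp)
      have := (d1.mul d2).mul ((hf x hx).pow 2)
      refine this.congr_deriv ?_
      have e : x1 = l + x0 := by rw [hl]; ring
      simp only [P', Pi.mul_apply, Pi.pow_apply]
      clear_value l
      subst e
      field_simp
      simp
      ring
    · exact c4.intervalIntegrable_of_Icc h01.le
  rw [intervalIntegral.integral_of_le h01.le, ← integral_Icc_eq_integral_Ioc] at hftc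
  have i1 := c1.integrableOn_Icc (μ := volume)
  have i2 := c2.integrableOn_Icc (μ := volume)
  have i3 := c3.integrableOn_Icc (μ := volume)
  have i4 := c4.integrableOn_Icc (μ := volume)
  have main : ∫ x in Icc x0 x1, f x ^ 2 ≤ 12 / l * (∫ x in Icc x0 x1, (x - x0) * (x1 - x) / l * f x ^ 2) +
      4 * ∫ x in Icc x0 x1, ((x - x0) * (x1 - x) / l) ^ 2 * f' x ^ 2 := by
    have : ∫ x in Icc x0 x1, f x ^ 2 ≤ ∫ x in Icc x0 x1, ((12 / l * ((x - x0) * (x1 - x) / l * f x ^ 2) +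
      4 * (((x - x0) * (x1 - x) / l) ^ 2 * f' x ^ 2)) + 2 * P' x) := by
      refine setIntegral_mono_on i1 (((i2.const_mul _).add (i3.const_mul _)).add (i4.const_mul _)) measurableSet_Icc ?_
      intro x hx
      set p := (x - x0) * (x1 - x) / l
      set g := (x0 + x1 - 2 * x) / l with hg
      have hg2 : g ^ 2 ≤ 1 := by
        rw [sq_le_one_iff_abs_le_one, hg, abs_div, abs_of_pos hlp, div_le_one hlp, abs_le]
        constructor <;> linarith [hx.1, hx.2]
      have k1 : 0 ≤ (f x + 2 * p * g * f' x) ^ 2 := sq_nonneg _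
      have k2 : 0 ≤ (1 - g ^ 2) * (p * f' x) ^ 2 := mul_nonneg (by linarith) (sq_nonneg _)
      simp only [P']
      have e : 6 / l = (12 / l) / 2 := by ring
      rw [e]
      nlinarith [k1, k2]
    have i23 : IntegrableOn (fun x => 12 / l * ((x - x0) * (x1 - x) / l * f x ^ 2) +
      4 * (((x - x0) * (x1 - x) / l) ^ 2 * f' x ^ 2)) (Icc x0 x1) := (i2.const_mul _).add (i3.const_mul _)
    rw [integral_add i23 (i4.const_mul 2),
      integral_add (i2.const_mul _) (i3.const_mul _), integral_const_mul, integral_const_mul,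
      integral_const_mul, hftc] at this
    linarith
  have nφ : ∀ x ∈ Icc x0 x1, 0 ≤ (x - x0) * (x1 - x) / l := fun x hx =>
    div_nonneg (mul_nonneg (by linarith [hx.1]) (by linarith [hx.2])) hlp.le
  have n2 : 0 ≤ᵐ[volume.restrict (Icc x0 x1)] (fun x => (x - x0) * (x1 - x) / l * f x ^ 2) :=
    (ae_restrict_iff' measurableSet_Icc).2 (Eventually.of_forall fun x hx =>
      mul_nonneg (nφ x hx) (sq_nonneg _))
  have n3 : 0 ≤ᵐ[volume.restrict (Icc x0 x1)] (fun x => ((x - x0) * (x1 - x) / l) ^ 2 * f' x ^ 2) :=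
    Eventually.of_forall fun x => by simp only [Pi.zero_apply]; positivity
  rw [← ofReal_integral_eq_lintegral_ofReal i1 (Eventually.of_forall fun x => sq_nonneg _),
    ← ofReal_integral_eq_lintegral_ofReal i2 n2, ← ofReal_integral_eq_lintegral_ofReal i3 n3]
  refine (ENNReal.ofReal_le_ofReal main).trans ?_
  refine ENNReal.ofReal_add_le.trans ?_
  rw [ENNReal.ofReal_mul (by positivity), ENNReal.ofReal_mul (by positivity)]
  simp

lemma dq_fderiv {f : ℝ × ℝ → ℝ} {z e w : ℝ × ℝ} {t : ℝ} (h1 : DifferentiableAt ℝ f z)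
    (h2 : DifferentiableAt ℝ f (z + e)) :
    fderiv ℝ (fun q => (f (q + e) - f q) / t) z w = (fderiv ℝ f (z + e) w - fderiv ℝ f z w) / t := by
  have d2 : HasFDerivAt (fun q => f (q + e)) (fderiv ℝ f (z + e)) z := by
    have := h2.hasFDerivAt.comp z ((hasFDerivAt_id z).add_const e)
    simp only [ContinuousLinearMap.comp_id, id] at this
    exact this
  have := ((d2.sub h1.hasFDerivAt).mul_const t⁻¹).fderiv
  have e1 : (fun q => (f (q + e) - f q) / t) = fun q => ((fun q => f (q + e)) - f) q * t⁻¹ := by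
    ext q; simp [div_eq_mul_inv]
  rw [e1, this]
  simp; ring

lemma dq_props {h a b t : ℝ} {u : ℝ × ℝ → ℝ} (ht : 0 < t)
    (hu : ContDiffOn ℝ 2 u (Ioo 0 h ×ˢ Ioo a b))
    (hl : ∀ p ∈ Ioo 0 h ×ˢ Ioo a b, lap u p = 0) :
    ContDiffOn ℝ 2 (fun q => (u (q + (t, 0)) - u q) / t) (Ioo 0 (h - t) ×ˢ Ioo a b) ∧
    (∀ p ∈ Ioo 0 (h - t) ×ˢ Ioo a b, lap (fun q => (u (q + (t, 0)) - u q) / t) p = 0) ∧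
    (∀ p ∈ Ioo 0 (h - t) ×ˢ Ioo a b, d₂ (fun q => (u (q + (t, 0)) - u q) / t) p =
      (d₂ u (p + (t, 0)) - d₂ u p) / t) := by
  have hU : IsOpen (Ioo 0 h ×ˢ Ioo a b) := isOpen_Ioo.prod isOpen_Ioo
  have hV : IsOpen (Ioo 0 (h - t) ×ˢ Ioo a b) := isOpen_Ioo.prod isOpen_Ioo
  have m1 : ∀ p ∈ Ioo 0 (h - t) ×ˢ Ioo a b, p ∈ Ioo 0 h ×ˢ Ioo a b := by
    rintro ⟨x, y⟩ ⟨hx, hy⟩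
    exact ⟨⟨hx.1, by linarith [hx.2]⟩, hy⟩
  have m2 : ∀ p ∈ Ioo 0 (h - t) ×ˢ Ioo a b, p + (t, 0) ∈ Ioo 0 h ×ˢ Ioo a b := by
    rintro ⟨x, y⟩ ⟨hx, hy⟩
    refine ⟨⟨by simp; linarith [hx.1], by simp; linarith [hx.2]⟩, by simpa using hy⟩
  obtain ⟨hp, hq⟩ := c1_facts hU hu
  have du : ∀ z ∈ Ioo 0 h ×ˢ Ioo a b, DifferentiableAt ℝ u z := fun z hz =>
    ((hu.differentiableOn (by norm_num)).differentiableAt (hU.mem_nhds hz))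
  have dp : ∀ z ∈ Ioo 0 h ×ˢ Ioo a b, DifferentiableAt ℝ (d₁ u) z := fun z hz =>
    ((hp.differentiableOn (by norm_num)).differentiableAt (hU.mem_nhds hz))
  have dq : ∀ z ∈ Ioo 0 h ×ˢ Ioo a b, DifferentiableAt ℝ (d₂ u) z := fun z hz =>
    ((hq.differentiableOn (by norm_num)).differentiableAt (hU.mem_nhds hz))
  have e1 : ∀ p ∈ Ioo 0 (h - t) ×ˢ Ioo a b, d₁ (fun q => (u (q + (t, 0)) - u q) / t) p =
      (d₁ u (p + (t, 0)) - d₁ u p) / t := fun p hp => dq_fderiv (du p (m1 p hp)) (du _ (m2 p hp))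
  have e2 : ∀ p ∈ Ioo 0 (h - t) ×ˢ Ioo a b, d₂ (fun q => (u (q + (t, 0)) - u q) / t) p =
      (d₂ u (p + (t, 0)) - d₂ u p) / t := fun p hp => dq_fderiv (du p (m1 p hp)) (du _ (m2 p hp))
  refine ⟨?_, ?_, e2⟩
  · have : ContDiffOn ℝ 2 (fun q => u (q + (t, 0))) (Ioo 0 (h - t) ×ˢ Ioo a b) :=
      hu.comp (contDiff_id.add contDiff_const).contDiffOn m2
    exact (this.sub (hu.mono m1)).div_const t
  · intro p hpV
    have f1 : (fun q => d₁ (fun q => (u (q + (t, 0)) - u q) / t) q) =ᶠ[𝓝 p]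
      fun q => (d₁ u (q + (t, 0)) - d₁ u q) / t := by
      filter_upwards [hV.mem_nhds hpV] with q hq using e1 q hq
    have f2 : (fun q => d₂ (fun q => (u (q + (t, 0)) - u q) / t) q) =ᶠ[𝓝 p]
      fun q => (d₂ u (q + (t, 0)) - d₂ u q) / t := by
      filter_upwards [hV.mem_nhds hpV] with q hq using e2 q hq
    have g1 := hl p (m1 p hpV)
    have g2 := hl _ (m2 p hpV)
    unfold lap at g1 g2 ⊢
    rw [f1.fderiv_eq, f2.fderiv_eq, dq_fderiv (dp p (m1 p hpV)) (dp _ (m2 p hpV)),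
      dq_fderiv (dq p (m1 p hpV)) (dq _ (m2 p hpV)), ← add_div]
    have : ∀ A B C D : ℝ, A + C = 0 → B + D = 0 → (B - A + (D - C)) / t = 0 := by
      intro A B C D h1 h2
      rw [show B - A + (D - C) = (B + D) - (A + C) by ring, h1, h2]; simp
    exact this _ _ _ _ g1 g2

lemma Wt.cont {a b : ℝ} {W W' W'' : ℝ → ℝ} (hW : Wt a b W W' W'') : ContinuousOn W (Ioo a b) := by
  exact fun y hy => (hW.d y hy).continuousAt.continuousWithinAt

lemma mix_symm {u : ℝ × ℝ → ℝ} {U : Set (ℝ × ℝ)} (hU : IsOpen U) (hu : ContDiffOn ℝ 2 u U)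
    {z : ℝ × ℝ} (hz : z ∈ U) : fderiv ℝ (d₂ u) z (1, 0) = fderiv ℝ (d₁ u) z (0, 1) := by
  have hs : IsSymmSndFDerivAt ℝ u z :=
    (hu.contDiffAt (hU.mem_nhds hz)).isSymmSndFDerivAt (by simp)
  have hd : DifferentiableAt ℝ (fderiv ℝ u) z :=
    ((hu.fderiv_of_isOpen (m := 1) hU (by norm_num)).differentiableOn (by norm_num)).differentiableAt
      (hU.mem_nhds hz)
  have e : ∀ w w' : ℝ × ℝ, fderiv ℝ (fun q => fderiv ℝ u q w) z w' = fderiv ℝ (fderiv ℝ u) z w' w := by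
    intro w w'
    have := (hd.hasFDerivAt.clm_apply (hasFDerivAt_const w z)).fderiv
    rw [this]; simp
  have h1 := e (0, 1) (1, 0)
  have h2 := e (1, 0) (0, 1)
  change fderiv ℝ (fun q => fderiv ℝ u q (0, 1)) z (1, 0) = fderiv ℝ (fun q => fderiv ℝ u q (1, 0)) z (0, 1)
  rw [h1, h2]
  exact hs.eq _ _

lemma jensen2 {h a b s t : ℝ} {u : ℝ × ℝ → ℝ} {W W' W'' : ℝ → ℝ} (hs : 0 < s) (ht : 0 < t) (hts : t < s)
    (hW : Wt a b W W' W'') (hu : ContDiffOn ℝ 2 u (Ioo 0 h ×ˢ Ioo a b)) :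
    ∫⁻ p in Icc s (h - s) ×ˢ Ioo a b, ENNReal.ofReal (W p.2 * ((u (p + (t, 0)) - u p) / t) ^ 2) ≤
    ∫⁻ p in Ioo 0 h ×ˢ Ioo a b, ENNReal.ofReal (W p.2 * d₁ u p ^ 2) := by
  have hU : IsOpen (Ioo 0 h ×ˢ Ioo a b) := isOpen_Ioo.prod isOpen_Ioo
  obtain ⟨hp, hq⟩ := c1_facts hU hu
  have m1 : MapsTo (fun p : ℝ × ℝ => p + (t, 0)) (Icc s (h - s) ×ˢ Ioo a b) (Ioo 0 h ×ˢ Ioo a b) := by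
    rintro ⟨x, y⟩ ⟨hx, hy⟩
    exact ⟨⟨by simp; linarith [hx.1], by simp; linarith [hx.2]⟩, by simpa using hy⟩
  have m0 : Icc s (h - s) ×ˢ Ioo a b ⊆ Ioo 0 h ×ˢ Ioo a b := by
    rintro ⟨x, y⟩ ⟨hx, hy⟩
    exact ⟨⟨by linarith [hx.1], by linarith [hx.2]⟩, hy⟩
  have cW : ∀ X : Set ℝ, ContinuousOn (fun p : ℝ × ℝ => W p.2) (X ×ˢ Ioo a b) := fun X =>
    hW.cont.comp continuousOn_snd (fun p hp => hp.2)
  have cv : ContinuousOn (fun p : ℝ × ℝ => (u (p + (t, 0)) - u p) / t) (Icc s (h - s) ×ˢ Ioo a b) :=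
    ((hu.continuousOn.comp (by fun_prop) m1).sub (hu.continuousOn.mono m0)).div_const t
  have mS : MeasurableSet (Icc s (h - s) ×ˢ Ioo a b) := measurableSet_Icc.prod measurableSet_Ioo
  rw [Measure.volume_eq_prod, setLIntegral_prod_symm, setLIntegral_prod_symm]
  · refine setLIntegral_mono' measurableSet_Ioo ?_
    intro y hy
    have e : ∀ (X : Set ℝ) (g : ℝ → ℝ), ∫⁻ x in X, ENNReal.ofReal (W y * g x ^ 2) =
        ENNReal.ofReal (W y) * ∫⁻ x in X, ENNReal.ofReal (g x ^ 2) := by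
      intro X g
      rw [← lintegral_const_mul' _ _ ENNReal.ofReal_ne_top]
      refine lintegral_congr fun x => ?_
      rw [ENNReal.ofReal_mul (hW.n y hy)]
    have e1 := e (Icc s (h - s)) (fun x => (u (x + t, y) - u (x, y)) / t)
    have e2 := e (Ioo 0 h) (fun x => d₁ u (x, y))
    simp only [Prod.mk_add_mk, add_zero]
    rw [e1, e2]
    refine mul_le_mul' le_rfl (jensen1 (f := fun x => u (x, y)) hs ht hts ?_ ?_)
    · intro x hx
      exact slice1 (z := (x, y)) ((hu.differentiableOn (by norm_num)).differentiableAt (hU.mem_nhds ⟨hx, hy⟩))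
    · exact hp.continuousOn.comp (by fun_prop) (fun x hx => ⟨hx, hy⟩)
  · exact (ENNReal.continuous_ofReal.comp_continuousOn ((cW _).mul (hp.continuousOn.pow 2))).aemeasurable hU.measurableSet
  · exact (ENNReal.continuous_ofReal.comp_continuousOn ((cW _).mul (cv.pow 2))).aemeasurable mS

lemma est2 {h a b s : ℝ} {u : ℝ × ℝ → ℝ} {W W' W'' φ φ' : ℝ → ℝ} (hs : 0 < s) (hsh : s ≤ h - s) (hab : a < b)
    (hW : Wt a b W W' W'')
    (hφ : ∀ x, HasDerivAt φ (φ' x) x) (hφc : Continuous φ')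
    (hφ0 : φ s = 0) (hφ1 : φ (h - s) = 0)
    (hφb : ∀ x ∈ Icc s (h - s), |φ' x| ≤ 1)
    (hu : ContDiffOn ℝ 2 u (Ioo 0 h ×ˢ Ioo a b))
    (hl : ∀ p ∈ Ioo 0 h ×ˢ Ioo a b, lap u p = 0)
    (hc : ContinuousOn u (Icc 0 h ×ˢ Icc a b))
    (hz : ∀ x ∈ Ioo 0 h, u (x, a) = 0 ∧ u (x, b) = 0) :
    ∫⁻ p in Icc s (h - s) ×ˢ Ioo a b, ENNReal.ofReal (φ p.1 ^ 2 * W p.2 * (fderiv ℝ (d₂ u) p (1, 0)) ^ 2) ≤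
    ∫⁻ p in Ioo 0 h ×ˢ Ioo a b, ENNReal.ofReal (W p.2 * d₁ u p ^ 2) := by
  have hU : IsOpen (Ioo 0 h ×ˢ Ioo a b) := isOpen_Ioo.prod isOpen_Ioo
  obtain ⟨hp, hq⟩ := c1_facts hU hu
  have mS : MeasurableSet (Icc s (h - s) ×ˢ Ioo a b) := measurableSet_Icc.prod measurableSet_Ioo
  have m0 : Icc s (h - s) ×ˢ Ioo a b ⊆ Ioo 0 h ×ˢ Ioo a b := by
    rintro ⟨x, y⟩ ⟨hx, hy⟩
    exact ⟨⟨by linarith [hx.1], by linarith [hx.2]⟩, hy⟩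
  have epos : ∀ n : ℕ, (0 : ℝ) < 1 / ((n : ℝ) + 1) := fun n => by positivity
  choose G G' J hG using fun n : ℕ => exists_cut (1 / ((n : ℝ) + 1)) (epos n)
  let t : ℕ → ℝ := fun n => s / ((n : ℝ) + 2)
  have tpos : ∀ n, 0 < t n := fun n => by simp only [t]; positivity
  have tlt : ∀ n, t n < s := fun n => by
    simp only [t]
    rw [div_lt_iff₀ (by positivity)]
    have : (0 : ℝ) ≤ n := n.cast_nonneg
    nlinarith
  have tlim : Tendsto t atTop (𝓝 0) := by
    refine Tendsto.div_atTop tendsto_const_nhds ?_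
    exact tendsto_atTop_add_const_right _ _ tendsto_natCast_atTop_atTop
  have tlim' : Tendsto t atTop (𝓝[≠] 0) :=
    tendsto_nhdsWithin_iff.2 ⟨tlim, Eventually.of_forall fun n => (tpos n).ne'⟩
  have elim : Tendsto (fun n : ℕ => 2 * (1 / ((n : ℝ) + 1))) atTop (𝓝 0) := by
    simpa using tendsto_one_div_add_atTop_nhds_zero_nat.const_mul (2 : ℝ)
  let v : ℕ → ℝ × ℝ → ℝ := fun n q => (u (q + (t n, 0)) - u q) / t n
  have P := fun n => dq_props (tpos n) hu hl
  have mV : ∀ n, Icc s (h - s) ×ˢ Ioo a b ⊆ Ioo 0 (h - t n) ×ˢ Ioo a b := by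
    rintro n ⟨x, y⟩ ⟨hx, hy⟩
    exact ⟨⟨by linarith [hx.1], by linarith [hx.2, tlt n]⟩, hy⟩
  have cW : ContinuousOn (fun p : ℝ × ℝ => W p.2) (Icc s (h - s) ×ˢ Ioo a b) :=
    hW.cont.comp continuousOn_snd (fun p hp => hp.2)
  have cφ : Continuous φ := continuous_iff_continuousAt.2 fun x => (hφ x).continuousAt
  refine fatou_bound (f := fun n p => ENNReal.ofReal (φ p.1 ^ 2 * W p.2 * d₂ (v n) p ^ 2 * G n (v n p ^ 2))) ?_ ?_ ?_
  · intro n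
    have hV : IsOpen (Ioo 0 (h - t n) ×ˢ Ioo a b) := isOpen_Ioo.prod isOpen_Ioo
    have c1 := (c1_facts hV (P n).1).2.continuousOn.mono (mV n)
    have c0 := (P n).1.continuousOn.mono (mV n)
    have cG : Continuous (G n) := continuous_iff_continuousAt.2 fun x => ((hG n).dG x).continuousAt
    have c2 : ContinuousOn (fun p : ℝ × ℝ => φ p.1 ^ 2) (Icc s (h - s) ×ˢ Ioo a b) := by fun_prop
    exact (ENNReal.continuous_ofReal.comp_continuousOn
      (((c2.mul cW).mul (c1.pow 2)).mul (cG.comp_continuousOn (c0.pow 2)))).aemeasurable mS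
  · intro n
    refine le_trans ?_ (jensen2 hs (tpos n) (tlt n) hW hu)
    refine est2a (epos n) (X0 := 0) (X1 := h - t n) hs hsh (by linarith [tlt n]) hab hW (hG n) hφ hφc hφ0 hφ1 hφb
      (P n).1 (P n).2.1 ?_ ?_
    · refine ContinuousOn.div_const (ContinuousOn.sub ?_ ?_) _
      · refine hc.comp (by fun_prop) ?_
        rintro ⟨x, y⟩ ⟨hx, hy⟩
        exact ⟨⟨by simp; linarith [hx.1, tpos n], by simp; linarith [hx.2, tlt n]⟩, by simpa using hy⟩
      · refine hc.mono ?_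
        rintro ⟨x, y⟩ ⟨hx, hy⟩
        exact ⟨⟨by linarith [hx.1], by linarith [hx.2]⟩, hy⟩
    · intro x hx
      have z1 := hz x ⟨by linarith [hx.1], by linarith [hx.2]⟩
      have z2 := hz (x + t n) ⟨by linarith [hx.1, tpos n], by linarith [hx.2, tlt n]⟩
      have key : ∀ y, u (x, y) = 0 → u (x + t n, y) = 0 → (u ((x, y) + (t n, 0)) - u (x, y)) / t n = 0 := by
        intro y h1 h2
        simp [h1, h2]
      exact ⟨key a z1.1 z2.1, key b z1.2 z2.2⟩
  · rw [ae_restrict_iff' mS]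
    have cf : ContinuousOn (fun z => fderiv ℝ (d₁ u) z (0, 1)) (Ioo 0 h ×ˢ Ioo a b) :=
      (hp.continuousOn_fderiv_of_isOpen hU (by norm_num)).clm_apply continuousOn_const
    have dp : ∀ z ∈ Ioo 0 h ×ˢ Ioo a b, DifferentiableAt ℝ (d₁ u) z := fun z hz =>
      ((hp.differentiableOn (by norm_num)).differentiableAt (hU.mem_nhds hz))
    have dq : ∀ z ∈ Ioo 0 h ×ˢ Ioo a b, DifferentiableAt ℝ (d₂ u) z := fun z hz =>
      ((hq.differentiableOn (by norm_num)).differentiableAt (hU.mem_nhds hz))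
    have du : ∀ z ∈ Ioo 0 h ×ˢ Ioo a b, DifferentiableAt ℝ u z := fun z hz =>
      ((hu.differentiableOn (by norm_num)).differentiableAt (hU.mem_nhds hz))
    have hae := ae_zero hU hp.continuousOn cf (fun z hz => slice2 (dp z hz))
    filter_upwards [hae] with z hzz hzS
    have hzU := m0 hzS
    have l1 : ∀ f : ℝ × ℝ → ℝ, DifferentiableAt ℝ f z →
        Tendsto (fun n => (f (z + (t n, 0)) - f z) / t n) atTop (𝓝 (fderiv ℝ f z (1, 0))) := by
      intro f hf
      have := (hasDerivAt_iff_tendsto_slope_zero.1 (slice1 hf)).comp tlim'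
      refine this.congr fun n => ?_
      have e : z + (t n, 0) = (z.1 + t n, z.2) := by ext <;> simp
      simp [e, div_eq_inv_mul]
    have lv : Tendsto (fun n => v n z) atTop (𝓝 (d₁ u z)) := l1 u (du z hzU)
    have l2 : Tendsto (fun n => d₂ (v n) z) atTop (𝓝 (fderiv ℝ (d₂ u) z (1, 0))) := by
      refine (l1 _ (dq z hzU)).congr fun n => ?_
      exact ((P n).2.2 z (mV n hzS)).symm
    refine (ENNReal.continuous_ofReal.tendsto _).comp ?_
    have l3 : Tendsto (fun n => φ z.1 ^ 2 * W z.2 * d₂ (v n) z ^ 2) atTop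
      (𝓝 (φ z.1 ^ 2 * W z.2 * (fderiv ℝ (d₂ u) z (1, 0)) ^ 2)) := (l2.pow 2).const_mul _
    by_cases h0 : d₁ u z = 0
    · have e0 : fderiv ℝ (d₂ u) z (1, 0) = 0 := by
        rw [mix_symm hU hu hzU]; exact hzz hzU h0
      rw [e0] at l3 ⊢
      simp only [ne_eq, OfNat.ofNat_ne_zero, not_false_eq_true, zero_pow, mul_zero] at l3 ⊢
      have nn : 0 ≤ W z.2 := hW.n _ hzS.2
      refine squeeze_zero (fun n => ?_) (fun n => ?_) l3
      · have := (hG n).nG (v n z ^ 2)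
        positivity
      · exact mul_le_of_le_one_right (by positivity) ((hG n).lG _)
    · have hp2 : 0 < d₁ u z ^ 2 := by positivity
      have ev : ∀ᶠ n : ℕ in atTop, 2 * (1 / ((n : ℝ) + 1)) < v n z ^ 2 :=
        (elim.eventually_lt (lv.pow 2) hp2)
      refine l3.congr' ?_
      filter_upwards [ev] with n hn
      rw [(hG n).oG _ hn.le, mul_one]

lemma comb {h a b s : ℝ} {u : ℝ × ℝ → ℝ} {W W' W'' : ℝ → ℝ} (hs : 0 < s) (hsh : s < h - s) (hab : a < b)
    (hW : Wt a b W W' W'')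
    (hu : ContDiffOn ℝ 2 u (Ioo 0 h ×ˢ Ioo a b))
    (hl : ∀ p ∈ Ioo 0 h ×ˢ Ioo a b, lap u p = 0)
    (hc : ContinuousOn u (Icc 0 h ×ˢ Icc a b))
    (hz : ∀ x ∈ Ioo 0 h, u (x, a) = 0 ∧ u (x, b) = 0)
    (hA : IntegrableOn (fun p => W p.2 * |u p * d₁ u p|) (Ioo 0 h ×ˢ Ioo a b)) :
    ∫⁻ p in Icc s (h - s) ×ˢ Ioo a b, ENNReal.ofReal (W p.2 * d₂ u p ^ 2) ≤
    ENNReal.ofReal (12 / (h - s - s) * ∫ p in Ioo 0 h ×ˢ Ioo a b, W p.2 * |u p * d₁ u p|) +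
      4 * ∫⁻ p in Ioo 0 h ×ˢ Ioo a b, ENNReal.ofReal (W p.2 * d₁ u p ^ 2) := by
  have hU : IsOpen (Ioo 0 h ×ˢ Ioo a b) := isOpen_Ioo.prod isOpen_Ioo
  obtain ⟨hp, hq⟩ := c1_facts hU hu
  have mS : MeasurableSet (Icc s (h - s) ×ˢ Ioo a b) := measurableSet_Icc.prod measurableSet_Ioo
  have m0 : Icc s (h - s) ×ˢ Ioo a b ⊆ Ioo 0 h ×ˢ Ioo a b := by
    rintro ⟨x, y⟩ ⟨hx, hy⟩
    exact ⟨⟨by linarith [hx.1], by linarith [hx.2]⟩, hy⟩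
  have m0' : Icc s (h - s) ×ˢ Icc a b ⊆ Icc 0 h ×ˢ Icc a b := by
    rintro ⟨x, y⟩ ⟨hx, hy⟩
    exact ⟨⟨by linarith [hx.1], by linarith [hx.2]⟩, hy⟩
  have dq : ∀ z ∈ Ioo 0 h ×ˢ Ioo a b, DifferentiableAt ℝ (d₂ u) z := fun z hz =>
    ((hq.differentiableOn (by norm_num)).differentiableAt (hU.mem_nhds hz))
  have cf : ContinuousOn (fun z => fderiv ℝ (d₂ u) z (1, 0)) (Ioo 0 h ×ˢ Ioo a b) :=
    (hq.continuousOn_fderiv_of_isOpen hU (by norm_num)).clm_apply continuousOn_const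
  have cW : ContinuousOn (fun p : ℝ × ℝ => W p.2) (Icc s (h - s) ×ˢ Ioo a b) :=
    hW.cont.comp continuousOn_snd (fun p hp => hp.2)
  have hlp : 0 < h - s - s := by linarith
  let φ : ℝ → ℝ := fun x => (x - s) * (h - s - x) / (h - s - s)
  let φ' : ℝ → ℝ := fun x => (s + (h - s) - 2 * x) / (h - s - s)
  have cφ : Continuous φ := by fun_prop
  have hφ : ∀ x, HasDerivAt φ (φ' x) x := by
    intro x
    have := (((hasDerivAt_id x).sub_const s).mul ((hasDerivAt_id x).const_sub (h - s))).div_const (h - s - s)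
    exact this.congr_deriv (by simp [φ']; ring)
  have hφc : Continuous φ' := by fun_prop
  have hφ0 : φ s = 0 := by simp [φ]
  have hφ1 : φ (h - s) = 0 := by simp [φ]
  have hφn : ∀ x ∈ Icc s (h - s), 0 ≤ φ x := fun x hx =>
    div_nonneg (mul_nonneg (by linarith [hx.1]) (by linarith [hx.2])) hlp.le
  have hφb : ∀ x ∈ Icc s (h - s), |φ' x| ≤ 1 := by
    intro x hx
    simp only [φ']
    rw [abs_div, abs_of_pos hlp, div_le_one hlp, abs_le]
    constructor <;> linarith [hx.1, hx.2]
  have E1 := est1 (X0 := 0) (X1 := h) hs hsh.le (by linarith) hab hW hφ hφc hφ0 hφ1 hφn hφb hu hl (hc.mono m0')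
    (fun x hx => hz x ⟨by linarith [hx.1], by linarith [hx.2]⟩) hA
  have E2 := est2 hs hsh.le hab hW hφ hφc hφ0 hφ1 hφb hu hl hc hz
  rw [ENNReal.ofReal_mul (by positivity)]
  refine le_trans ?_ (add_le_add (mul_le_mul' le_rfl E1) (mul_le_mul' le_rfl E2))
  have c1 := hq.continuousOn.mono m0
  have c2 := cf.mono m0
  have cp : ContinuousOn (fun p : ℝ × ℝ => φ p.1) (Icc s (h - s) ×ˢ Ioo a b) := by fun_prop
  have a1 : AEMeasurable (fun p : ℝ × ℝ => ENNReal.ofReal (W p.2 * d₂ u p ^ 2)) (volume.restrict (Icc s (h - s) ×ˢ Ioo a b)) :=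
    (ENNReal.continuous_ofReal.comp_continuousOn (cW.mul (c1.pow 2))).aemeasurable mS
  have a2 : AEMeasurable (fun p : ℝ × ℝ => ENNReal.ofReal (φ p.1 * W p.2 * d₂ u p ^ 2)) (volume.restrict (Icc s (h - s) ×ˢ Ioo a b)) :=
    (ENNReal.continuous_ofReal.comp_continuousOn ((cp.mul cW).mul (c1.pow 2))).aemeasurable mS
  have a3 : AEMeasurable (fun p : ℝ × ℝ => ENNReal.ofReal (φ p.1 ^ 2 * W p.2 * (fderiv ℝ (d₂ u) p (1, 0)) ^ 2)) (volume.restrict (Icc s (h - s) ×ˢ Ioo a b)) :=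
    (ENNReal.continuous_ofReal.comp_continuousOn (((cp.pow 2).mul cW).mul (c2.pow 2))).aemeasurable mS
  rw [← lintegral_const_mul'' _ a2, ← lintegral_const_mul'' _ a3, ← lintegral_add_left' (a2.const_mul _)]
  have a4 : AEMeasurable (fun p : ℝ × ℝ => ENNReal.ofReal (12 / (h - s - s)) * ENNReal.ofReal (φ p.1 * W p.2 * d₂ u p ^ 2) +
      4 * ENNReal.ofReal (φ p.1 ^ 2 * W p.2 * (fderiv ℝ (d₂ u) p (1, 0)) ^ 2)) (volume.restrict (Icc s (h - s) ×ˢ Ioo a b)) :=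
    (a2.const_mul (ENNReal.ofReal (12 / (h - s - s)))).add (a3.const_mul 4)
  rw [Measure.volume_eq_prod] at a1 a4 ⊢
  rw [setLIntegral_prod_symm _ a1, setLIntegral_prod_symm _ a4]
  refine setLIntegral_mono' measurableSet_Ioo fun y hy => ?_
  have mm : ∀ x ∈ Icc s (h - s), (x, y) ∈ Ioo 0 h ×ˢ Ioo a b := fun x hx => m0 ⟨hx, hy⟩
  have b1 : ContinuousOn (fun x => d₂ u (x, y)) (Icc s (h - s)) :=
    hq.continuousOn.comp (by fun_prop) mm
  have b2 : ContinuousOn (fun x => fderiv ℝ (d₂ u) (x, y) (1, 0)) (Icc s (h - s)) :=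
    cf.comp (f := fun x => (x, y)) (by fun_prop) mm
  have H := hardy1 (f := fun x => d₂ u (x, y)) hsh
    (fun x hx => slice1 (z := (x, y)) (dq _ (mm x hx))) b2
  have wn := hW.n y hy
  have a5 : AEMeasurable (fun x : ℝ => ENNReal.ofReal (φ x * d₂ u (x, y) ^ 2)) (volume.restrict (Icc s (h - s))) :=
    (ENNReal.continuous_ofReal.comp_continuousOn (cφ.continuousOn.mul (b1.pow 2))).aemeasurable measurableSet_Icc
  have a6 : AEMeasurable (fun x : ℝ => ENNReal.ofReal (φ x ^ 2 * (fderiv ℝ (d₂ u) (x, y) (1, 0)) ^ 2)) (volume.restrict (Icc s (h - s))) :=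
    (ENNReal.continuous_ofReal.comp_continuousOn ((cφ.continuousOn.pow 2).mul (b2.pow 2))).aemeasurable measurableSet_Icc
  have H2 := mul_le_mul' (le_refl (ENNReal.ofReal (W y))) H
  change _ ≤ _ * (_ * (∫⁻ x in Icc s (h - s), ENNReal.ofReal (φ x * d₂ u (x, y) ^ 2)) +
    4 * ∫⁻ x in Icc s (h - s), ENNReal.ofReal (φ x ^ 2 * (fderiv ℝ (d₂ u) (x, y) (1, 0)) ^ 2)) at H2
  rw [← lintegral_const_mul'' _ a5, ← lintegral_const_mul'' _ a6, ← lintegral_add_left' (a5.const_mul _),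
    ← lintegral_const_mul' _ _ ENNReal.ofReal_ne_top, ← lintegral_const_mul' _ _ ENNReal.ofReal_ne_top] at H2
  refine le_trans (le_of_eq ?_) (H2.trans (le_of_eq ?_))
  · refine lintegral_congr fun x => ?_
    rw [ENNReal.ofReal_mul wn]
  · refine lintegral_congr fun x => ?_
    rw [show φ x * W y * d₂ u (x, y) ^ 2 = W y * (φ x * d₂ u (x, y) ^ 2) by ring,
      show φ x ^ 2 * W y * (fderiv ℝ (d₂ u) (x, y) (1, 0)) ^ 2 = W y * (φ x ^ 2 * (fderiv ℝ (d₂ u) (x, y) (1, 0)) ^ 2) by ring,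
      ENNReal.ofReal_mul wn, ENNReal.ofReal_mul wn]
    ring

lemma fatou_lim {X : Type*} [MeasurableSpace X] {μ : Measure X} {f : ℕ → X → ENNReal} {g : X → ENNReal}
    {C : ℕ → ENNReal} {C0 : ENNReal} (hf : ∀ n, AEMeasurable (f n) μ) (hC : ∀ n, ∫⁻ x, f n x ∂μ ≤ C n)
    (hC0 : Tendsto C atTop (𝓝 C0))
    (hl : ∀ᵐ x ∂μ, Tendsto (fun n => f n x) atTop (𝓝 (g x))) : ∫⁻ x, g x ∂μ ≤ C0 := by
  calc ∫⁻ x, g x ∂μ = ∫⁻ x, liminf (fun n => f n x) atTop ∂μ := by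
        refine lintegral_congr_ae ?_
        filter_upwards [hl] with x hx using hx.liminf_eq.symm
    _ ≤ liminf (fun n => ∫⁻ x, f n x ∂μ) atTop := lintegral_liminf_le' hf
    _ ≤ liminf C atTop := liminf_le_liminf (Eventually.of_forall hC)
    _ = C0 := hC0.liminf_eq

lemma comb_lim {h a b : ℝ} {u : ℝ × ℝ → ℝ} {W W' W'' : ℝ → ℝ} (hh : 0 < h) (hab : a < b)
    (hW : Wt a b W W' W'')
    (hu : ContDiffOn ℝ 2 u (Ioo 0 h ×ˢ Ioo a b))
    (hl : ∀ p ∈ Ioo 0 h ×ˢ Ioo a b, lap u p = 0)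
    (hc : ContinuousOn u (Icc 0 h ×ˢ Icc a b))
    (hz : ∀ x ∈ Ioo 0 h, u (x, a) = 0 ∧ u (x, b) = 0)
    (hA : IntegrableOn (fun p => W p.2 * |u p * d₁ u p|) (Ioo 0 h ×ˢ Ioo a b)) :
    ∫⁻ p in Ioo 0 h ×ˢ Ioo a b, ENNReal.ofReal (W p.2 * d₂ u p ^ 2) ≤
    ENNReal.ofReal (12 / h * ∫ p in Ioo 0 h ×ˢ Ioo a b, W p.2 * |u p * d₁ u p|) +
      4 * ∫⁻ p in Ioo 0 h ×ˢ Ioo a b, ENNReal.ofReal (W p.2 * d₁ u p ^ 2) := by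
  have hU : IsOpen (Ioo 0 h ×ˢ Ioo a b) := isOpen_Ioo.prod isOpen_Ioo
  obtain ⟨hp, hq⟩ := c1_facts hU hu
  let s : ℕ → ℝ := fun n => h / 2 / ((n : ℝ) + 2)
  have spos : ∀ n, 0 < s n := fun n => by simp only [s]; positivity
  have slt : ∀ n, s n < h / 2 := fun n => by
    simp only [s]
    rw [div_lt_iff₀ (by positivity)]
    have : (0 : ℝ) ≤ n := n.cast_nonneg
    nlinarith
  have slim : Tendsto s atTop (𝓝 0) := by
    refine Tendsto.div_atTop tendsto_const_nhds ?_
    exact tendsto_atTop_add_const_right _ _ tendsto_natCast_atTop_atTop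
  have mS : ∀ n, MeasurableSet (Icc (s n) (h - s n) ×ˢ Ioo a b) := fun n => measurableSet_Icc.prod measurableSet_Ioo
  have m0 : ∀ n, Icc (s n) (h - s n) ×ˢ Ioo a b ⊆ Ioo 0 h ×ˢ Ioo a b := by
    rintro n ⟨x, y⟩ ⟨hx, hy⟩
    exact ⟨⟨by linarith [hx.1, spos n], by linarith [hx.2, spos n]⟩, hy⟩
  have cW : ContinuousOn (fun p : ℝ × ℝ => W p.2) (Ioo 0 h ×ˢ Ioo a b) :=
    hW.cont.comp continuousOn_snd (fun p hp => hp.2)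
  have cc : ContinuousOn (fun p : ℝ × ℝ => ENNReal.ofReal (W p.2 * d₂ u p ^ 2)) (Ioo 0 h ×ˢ Ioo a b) :=
    (ENNReal.continuous_ofReal.comp_continuousOn (cW.mul (hq.continuousOn.pow 2)))
  rw [← lintegral_indicator hU.measurableSet]
  refine fatou_lim (f := fun n => (Icc (s n) (h - s n) ×ˢ Ioo a b).indicator
    (fun p : ℝ × ℝ => ENNReal.ofReal (W p.2 * d₂ u p ^ 2))) (C := fun n =>
    ENNReal.ofReal (12 / (h - s n - s n) * ∫ p in Ioo 0 h ×ˢ Ioo a b, W p.2 * |u p * d₁ u p|) +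
      4 * ∫⁻ p in Ioo 0 h ×ˢ Ioo a b, ENNReal.ofReal (W p.2 * d₁ u p ^ 2)) ?_ ?_ ?_ ?_
  · intro n
    exact (aemeasurable_indicator_iff (mS n)).2 ((cc.mono (m0 n)).aemeasurable (mS n))
  · intro n
    rw [lintegral_indicator (mS n)]
    exact comb (spos n) (by linarith [slt n]) hab hW hu hl hc hz hA
  · refine Tendsto.add ?_ tendsto_const_nhds
    refine (ENNReal.continuous_ofReal.tendsto _).comp ?_
    refine Tendsto.mul_const _ ?_
    refine Tendsto.div tendsto_const_nhds ?_ hh.ne'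
    simpa using (tendsto_const_nhds (x := h)).sub slim |>.sub slim
  · refine Eventually.of_forall fun z => ?_
    by_cases hz : z ∈ Ioo 0 h ×ˢ Ioo a b
    · rw [indicator_of_mem hz]
      refine tendsto_const_nhds.congr' ?_
      filter_upwards [slim.eventually_lt_const hz.1.1, slim.eventually_lt_const (sub_pos.2 hz.1.2)] with n h1 h2
      rw [indicator_of_mem]
      exact ⟨⟨h1.le, by linarith⟩, hz.2⟩
    · rw [indicator_of_notMem hz]
      refine tendsto_const_nhds.congr fun n => ?_
      rw [indicator_of_notMem]
      exact fun h => hz (m0 n h)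

lemma final_ineq {h a b M : ℝ} {u : ℝ × ℝ → ℝ} {W W' W'' : ℝ → ℝ} (hh : 0 < h) (hab : a < b)
    (hW : Wt a b W W' W'') (hM : ∀ y ∈ Ioo a b, W y ≤ M)
    (hu : ContDiffOn ℝ 2 u (Ioo 0 h ×ˢ Ioo a b))
    (hl : ∀ p ∈ Ioo 0 h ×ˢ Ioo a b, lap u p = 0)
    (hc : ContinuousOn u (Icc 0 h ×ˢ Icc a b))
    (hz : ∀ x ∈ Ioo 0 h, u (x, a) = 0 ∧ u (x, b) = 0)
    (hI : IntegrableOn (fun p => W p.2 * (d₁ u p ^ 2 + d₂ u p ^ 2)) (Ioo 0 h ×ˢ Ioo a b)) :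
    ∫ p in Ioo 0 h ×ˢ Ioo a b, W p.2 * (d₁ u p ^ 2 + d₂ u p ^ 2) ≤
    12 * (√(∫ p in Ioo 0 h ×ˢ Ioo a b, W p.2 * u p ^ 2) * √(∫ p in Ioo 0 h ×ˢ Ioo a b, W p.2 * d₁ u p ^ 2) / h +
      ∫ p in Ioo 0 h ×ˢ Ioo a b, W p.2 * d₁ u p ^ 2) := by
  have hU : IsOpen (Ioo 0 h ×ˢ Ioo a b) := isOpen_Ioo.prod isOpen_Ioo
  obtain ⟨hp, hq⟩ := c1_facts hU hu
  have mU := hU.measurableSet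
  have cW : ContinuousOn (fun p : ℝ × ℝ => W p.2) (Ioo 0 h ×ˢ Ioo a b) :=
    hW.cont.comp continuousOn_snd (fun p hp => hp.2)
  have I1 : IntegrableOn (fun p => W p.2 * d₁ u p ^ 2) (Ioo 0 h ×ˢ Ioo a b) := by
    refine Integrable.mono' hI ((cW.mul (hp.continuousOn.pow 2)).aestronglyMeasurable mU) ?_
    refine (ae_restrict_iff' mU).2 (Eventually.of_forall fun p hp => ?_)
    have wn := hW.n _ hp.2
    rw [Real.norm_of_nonneg (by positivity)]
    exact mul_le_mul_of_nonneg_left (by nlinarith [sq_nonneg (d₂ u p)]) wn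
  have I2 : IntegrableOn (fun p => W p.2 * d₂ u p ^ 2) (Ioo 0 h ×ˢ Ioo a b) := by
    refine Integrable.mono' hI ((cW.mul (hq.continuousOn.pow 2)).aestronglyMeasurable mU) ?_
    refine (ae_restrict_iff' mU).2 (Eventually.of_forall fun p hp => ?_)
    have wn := hW.n _ hp.2
    rw [Real.norm_of_nonneg (by positivity)]
    exact mul_le_mul_of_nonneg_left (by nlinarith [sq_nonneg (d₁ u p)]) wn
  have I0 : IntegrableOn (fun p => W p.2 * u p ^ 2) (Ioo 0 h ×ˢ Ioo a b) := by
    obtain ⟨K, hK⟩ := (isCompact_Icc.prod isCompact_Icc).exists_bound_of_continuousOn (hc.pow 2)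
    have fin : volume (Ioo 0 h ×ˢ Ioo a b) < ⊤ := by
      rw [Measure.volume_eq_prod, Measure.prod_prod, Real.volume_Ioo, Real.volume_Ioo]
      exact ENNReal.mul_lt_top ENNReal.ofReal_lt_top ENNReal.ofReal_lt_top
    have ic : IntegrableOn (fun _ : ℝ × ℝ => M * K) (Ioo 0 h ×ˢ Ioo a b) := integrableOn_const fin.ne
    refine Integrable.mono' ic ((cW.mul (hu.continuousOn.pow 2)).aestronglyMeasurable mU) ?_
    refine (ae_restrict_iff' mU).2 (Eventually.of_forall fun p hp => ?_)
    have wn := hW.n _ hp.2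
    have k1 := hM _ hp.2
    have k2 := hK p ⟨Ioo_subset_Icc_self hp.1, Ioo_subset_Icc_self hp.2⟩
    rw [Pi.pow_apply, Real.norm_of_nonneg (sq_nonneg (u p))] at k2
    rw [Real.norm_of_nonneg (by positivity)]
    exact mul_le_mul k1 k2 (sq_nonneg _) (wn.trans k1)
  have IA : IntegrableOn (fun p => W p.2 * |u p * d₁ u p|) (Ioo 0 h ×ˢ Ioo a b) := by
    refine Integrable.mono' (I0.add I1) ((cW.mul (hu.continuousOn.mul hp.continuousOn).abs).aestronglyMeasurable mU) ?_
    refine (ae_restrict_iff' mU).2 (Eventually.of_forall fun p hp => ?_)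
    have wn := hW.n _ hp.2
    rw [Real.norm_of_nonneg (by positivity)]
    simp only [Pi.add_apply]
    rw [← mul_add]
    refine mul_le_mul_of_nonneg_left ?_ wn
    rw [abs_mul, ← sq_abs (u p), ← sq_abs (d₁ u p)]
    nlinarith [sq_nonneg (|u p| - |d₁ u p|), sq_nonneg |u p|, sq_nonneg |d₁ u p|]
  set A2 := ∫ p in Ioo 0 h ×ˢ Ioo a b, W p.2 * u p ^ 2 with hA2
  set B2 := ∫ p in Ioo 0 h ×ˢ Ioo a b, W p.2 * d₁ u p ^ 2 with hB2
  have E := comb_lim hh hab hW hu hl hc hz IA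
  set X := ∫ p in Ioo 0 h ×ˢ Ioo a b, W p.2 * |u p * d₁ u p| with hX
  have nA : 0 ≤ A2 := setIntegral_nonneg mU fun p hp => mul_nonneg (hW.n _ hp.2) (sq_nonneg _)
  have nB : 0 ≤ B2 := setIntegral_nonneg mU fun p hp => mul_nonneg (hW.n _ hp.2) (sq_nonneg _)
  have nX : 0 ≤ X := setIntegral_nonneg mU fun p hp => mul_nonneg (hW.n _ hp.2) (abs_nonneg _)
  have cs : X ≤ √A2 * √B2 := by
    have quad : ∀ t : ℝ, 0 ≤ B2 * (t * t) + (-2 * X) * t + A2 := by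
      intro t
      have n0 : 0 ≤ ∫ p in Ioo 0 h ×ˢ Ioo a b, W p.2 * (|u p| - t * |d₁ u p|) ^ 2 :=
        setIntegral_nonneg mU fun p hp => mul_nonneg (hW.n _ hp.2) (sq_nonneg _)
      have e1 : ∫ p in Ioo 0 h ×ˢ Ioo a b, W p.2 * (|u p| - t * |d₁ u p|) ^ 2 =
          ∫ p in Ioo 0 h ×ˢ Ioo a b, ((t * t) * (W p.2 * d₁ u p ^ 2) + (-2 * t) * (W p.2 * |u p * d₁ u p|)) + W p.2 * u p ^ 2 := by
        refine setIntegral_congr_fun mU fun p _ => ?_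
        rw [abs_mul, ← sq_abs (u p), ← sq_abs (d₁ u p)]
        ring
      have i12 : IntegrableOn (fun p => (t * t) * (W p.2 * d₁ u p ^ 2) + (-2 * t) * (W p.2 * |u p * d₁ u p|)) (Ioo 0 h ×ˢ Ioo a b) :=
        (I1.const_mul _).add (IA.const_mul _)
      rw [e1, integral_add i12 I0, integral_add (I1.const_mul _) (IA.const_mul _), integral_const_mul,
        integral_const_mul, ← hA2, ← hB2, ← hX] at n0
      linarith
    have D := discrim_le_zero quad
    unfold discrim at D
    rw [← Real.sqrt_mul nA]
    exact Real.le_sqrt_of_sq_le (by nlinarith)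
  rw [← ofReal_integral_eq_lintegral_ofReal I2
      ((ae_restrict_iff' mU).2 (Eventually.of_forall fun p hp => mul_nonneg (hW.n _ hp.2) (sq_nonneg _))),
    ← ofReal_integral_eq_lintegral_ofReal I1
      ((ae_restrict_iff' mU).2 (Eventually.of_forall fun p hp => mul_nonneg (hW.n _ hp.2) (sq_nonneg _))),
    ← hB2, show (4 : ENNReal) = ENNReal.ofReal 4 by simp, ← ENNReal.ofReal_mul (by norm_num),
    ← ENNReal.ofReal_add (by positivity) (by positivity), ENNReal.ofReal_le_ofReal_iff (by positivity)] at E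
  have tot : ∫ p in Ioo 0 h ×ˢ Ioo a b, W p.2 * (d₁ u p ^ 2 + d₂ u p ^ 2) = B2 +
      ∫ p in Ioo 0 h ×ˢ Ioo a b, W p.2 * d₂ u p ^ 2 := by
    rw [hB2, ← integral_add I1 I2]
    exact setIntegral_congr_fun mU fun p _ => by ring
  rw [tot]
  have k : 12 / h * X ≤ 12 / h * (√A2 * √B2) := mul_le_mul_of_nonneg_left cs (by positivity)
  have k' : 12 / h * (√A2 * √B2) = 12 * (√A2 * √B2 / h) := by ring
  linarith

lemma wt_pow {k : ℕ} {a b β : ℝ} (hβ : β ≤ 1 / 2) (c α : Fin k → ℝ) (hc : ∀ i, 0 ≤ c i)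
    (hα : ∀ i, α i ∈ Icc 0 β) :
    ∃ W' W'', Wt a b (fun y => (∑ i, c i * (y - a) ^ α i) ^ 2) W' W'' := by
  have hp : ∀ y ∈ Ioo a b, 0 < y - a := fun y hy => sub_pos.2 hy.1
  have hd : ∀ y ∈ Ioo a b, ∀ γ : ℝ, HasDerivAt (fun y => (y - a) ^ γ) (γ * (y - a) ^ (γ - 1)) y := by
    intro y hy γ
    have := ((hasDerivAt_id y).sub_const a).rpow_const (p := γ) (Or.inl (hp y hy).ne')
    exact this.congr_deriv (by simp)
  refine ⟨fun y => ∑ i, ∑ j, c i * c j * ((α i + α j) * (y - a) ^ (α i + α j - 1)),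
    fun y => ∑ i, ∑ j, c i * c j * ((α i + α j) * ((α i + α j - 1) * (y - a) ^ (α i + α j - 1 - 1))), ?_, ?_, ?_, ?_, ?_⟩
  · intro y hy
    have e : (fun y => (∑ i, c i * (y - a) ^ α i) ^ 2) =ᶠ[𝓝 y]
        fun y => ∑ i, ∑ j, c i * c j * (y - a) ^ (α i + α j) := by
      filter_upwards [isOpen_Ioo.mem_nhds hy] with z hz
      rw [sq, Finset.sum_mul_sum]
      refine Finset.sum_congr rfl fun i _ => Finset.sum_congr rfl fun j _ => ?_
      rw [Real.rpow_add (hp z hz)]; ring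
    refine HasDerivAt.congr_of_eventuallyEq ?_ e
    exact HasDerivAt.fun_sum fun i _ => HasDerivAt.fun_sum fun j _ => (hd y hy _).const_mul _
  · intro y hy
    exact HasDerivAt.fun_sum fun i _ => HasDerivAt.fun_sum fun j _ => ((hd y hy _).const_mul _).const_mul _
  · refine continuousOn_finsetSum _ fun i _ => continuousOn_finsetSum _ fun j _ => ?_
    refine continuousOn_const.mul (continuousOn_const.mul (continuousOn_const.mul ?_))
    exact fun y hy => (hd y hy _).continuousAt.continuousWithinAt
  · intro y _
    exact sq_nonneg _
  · intro y hy
    refine Finset.sum_nonpos fun i _ => Finset.sum_nonpos fun j _ => ?_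
    have h1 := hα i
    have h2 := hα j
    have h3 := Real.rpow_nonneg (hp y hy).le (α i + α j - 1 - 1)
    refine mul_nonpos_of_nonneg_of_nonpos (mul_nonneg (hc i) (hc j)) ?_
    refine mul_nonpos_of_nonneg_of_nonpos (by linarith [h1.1, h2.1]) ?_
    exact mul_nonpos_of_nonpos_of_nonneg (by linarith [h1.2, h2.2]) h3


/-- **Theorem 2.1, case `n = 2`, `L = Δ`.**  On the thin rectangle `Ω = (0,h) × (a,b)`, with
`Γ₁ = {a}`, `δ(x₁,x₂) = x₂ - a`, weight `w = ∑ cᵢ δ^{αᵢ}` with `cᵢ ≥ 0` and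
`αᵢ ∈ [0,β] ⊆ [0,1/2]`, every `u ∈ C²(Ω) ∩ C(Ω̄)` harmonic in `Ω` with `u = 0` on
`(0,h) × {a,b}` satisfies `‖w∇u‖² ≤ C (‖wu‖·‖w u_{x₁}‖ / h + ‖w u_{x₁}‖²)`,
where `C` depends only on `k` and `β`; no ellipticity condition on `β` is needed. -/
theorem weighted_gradient_separation_laplacian_dim_two
    (k : ℕ) (β : ℝ) (hβ : β ∈ Set.Icc (0 : ℝ) (1 / 2)) :
    ∃ C : ℝ, 0 < C ∧
      ∀ (a b h : ℝ), a < b → 0 < h →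
      ∀ (c α : Fin k → ℝ), (∀ i, 0 ≤ c i) → (∀ i, α i ∈ Set.Icc 0 β) →
      ∀ u : ℝ × ℝ → ℝ,
        ContDiffOn ℝ 2 u (Set.Ioo 0 h ×ˢ Set.Ioo a b) →
        ContinuousOn u (closure (Set.Ioo 0 h ×ˢ Set.Ioo a b)) →
        (∀ p ∈ Set.Ioo 0 h ×ˢ Set.Ioo a b, lap u p = 0) →
        (∀ x ∈ Set.Ioo 0 h, u (x, a) = 0 ∧ u (x, b) = 0) →
        (∫ p in Set.Ioo 0 h ×ˢ Set.Ioo a b,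
            (∑ i : Fin k, c i * (p.2 - a) ^ α i) ^ 2 * ((d₁ u p) ^ 2 + (d₂ u p) ^ 2)) ≤
          C * (Real.sqrt (∫ p in Set.Ioo 0 h ×ˢ Set.Ioo a b,
                  (∑ i : Fin k, c i * (p.2 - a) ^ α i) ^ 2 * (u p) ^ 2) *
                Real.sqrt (∫ p in Set.Ioo 0 h ×ˢ Set.Ioo a b,
                  (∑ i : Fin k, c i * (p.2 - a) ^ α i) ^ 2 * (d₁ u p) ^ 2) / h +
              ∫ p in Set.Ioo 0 h ×ˢ Set.Ioo a b,
                (∑ i : Fin k, c i * (p.2 - a) ^ α i) ^ 2 * (d₁ u p) ^ 2) := by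
  refine ⟨12, by norm_num, ?_⟩
  intro a b h hab hh c α hc hα u hu hcl hl hz
  rw [closure_prod_eq, closure_Ioo hh.ne, closure_Ioo hab.ne] at hcl
  by_cases hI : IntegrableOn (fun p : ℝ × ℝ => (∑ i : Fin k, c i * (p.2 - a) ^ α i) ^ 2 *
      ((d₁ u p) ^ 2 + (d₂ u p) ^ 2)) (Set.Ioo 0 h ×ˢ Set.Ioo a b)
  · obtain ⟨W', W'', hW⟩ := wt_pow (a := a) (b := b) hβ.2 c α hc hα
    refine final_ineq (M := (∑ i, c i * (b - a) ^ α i) ^ 2)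
      (W := fun y => (∑ i, c i * (y - a) ^ α i) ^ 2) hh hab hW ?_ hu hl hcl hz hI
    intro y hy
    have hy0 : 0 ≤ y - a := by linarith [hy.1]
    refine pow_le_pow_left₀ (Finset.sum_nonneg fun i _ => mul_nonneg (hc i) (Real.rpow_nonneg hy0 _)) ?_ 2
    refine Finset.sum_le_sum fun i _ => mul_le_mul_of_nonneg_left ?_ (hc i)
    exact Real.rpow_le_rpow hy0 (by linarith [hy.2]) (hα i).1
  · rw [integral_undef hI]
    have nB : 0 ≤ ∫ p in Set.Ioo 0 h ×ˢ Set.Ioo a b,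
        (∑ i : Fin k, c i * (p.2 - a) ^ α i) ^ 2 * (d₁ u p) ^ 2 :=
      integral_nonneg fun p => by positivity
    positivity
end

section
/- Let a, h > 0, R = (0,h) × (0,a), γ = 2α with α ∈ [0,1/2), and let 𝐔 = (u,v) ∈ C¹(R̄,ℝ²) ∩ H¹(R,ℝ²). Let ũ ∈ H¹(R) be the unique solution of the Dirichlet problem Δũ = 0 in R, ũ = u on ∂R. Then ‖y^α ∇(u − ũ)‖_{L²(R)} ≤ (4/(1−γ)) ‖y^α e(𝐔)‖_{L²(R)}, where e(𝐔) = (∇𝐔 + ∇𝐔ᵀ)/2 and y denotes the second coordinate in R. -/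
open MeasureTheory Set

/-- Squared Frobenius norm of the symmetrized gradient `e(𝐔) = (∇𝐔 + ∇𝐔ᵀ)/2`. -/
noncomputable def strainNormSq (U : ℝ × ℝ → ℝ × ℝ) (p : ℝ × ℝ) : ℝ :=
  (d₁ (fun q => (U q).1) p) ^ 2 + (d₂ (fun q => (U q).2) p) ^ 2 +
  2 * ((d₂ (fun q => (U q).1) p + d₁ (fun q => (U q).2) p) / 2) ^ 2


lemma aux_contDiff_mul {O : Set (ℝ × ℝ)} (hO : IsOpen O) {f g : ℝ × ℝ → ℝ}
    (hf : ContDiffOn ℝ 1 f O) (hg : ContDiff ℝ 1 g) (hs : tsupport g ⊆ O) :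
    ContDiff ℝ 1 (fun x => g x * f x) := by
  rw [contDiff_iff_contDiffAt]
  intro x
  by_cases hx : x ∈ tsupport g
  · exact hg.contDiffAt.mul (hf.contDiffAt (hO.mem_nhds (hs hx)))
  · have h1 := notMem_tsupport_iff_eventuallyEq.mp hx
    refine (contDiffAt_const (c := (0:ℝ))).congr_of_eventuallyEq ?_
    filter_upwards [h1] with y hy
    simp [hy]

lemma aux_cont_mul {O : Set (ℝ × ℝ)} (hO : IsOpen O) {f g : ℝ × ℝ → ℝ}
    (hf : ContinuousOn f O) (hg : Continuous g) (hs : tsupport g ⊆ O) :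
    Continuous (fun x => f x * g x) := by
  have h : tsupport (fun x => f x * g x) ⊆ tsupport g := tsupport_mul_subset_right
  exact ((hf.mul hg.continuousOn).continuous_of_tsupport_subset hO (h.trans hs))

lemma aux_int_mul {O : Set (ℝ × ℝ)} (hO : IsOpen O) {f g : ℝ × ℝ → ℝ}
    (hf : ContinuousOn f O) (hg : Continuous g) (hs : tsupport g ⊆ O) (hc : HasCompactSupport g) :
    Integrable (fun x => f x * g x) := by
  exact (aux_cont_mul hO hf hg hs).integrable_of_hasCompactSupport hc.mul_left

lemma aux_dcont {O : Set (ℝ × ℝ)} (hO : IsOpen O) {f : ℝ × ℝ → ℝ}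
    (hf : ContDiffOn ℝ 1 f O) (v : ℝ × ℝ) : ContinuousOn (fun x => fderiv ℝ f x v) O :=
  (hf.continuousOn_fderiv_of_isOpen hO le_rfl).clm_apply continuousOn_const

lemma aux_ts {g : ℝ × ℝ → ℝ} (v : ℝ × ℝ) : tsupport (fun x => fderiv ℝ g x v) ⊆ tsupport g :=
  tsupport_fderiv_apply_subset ℝ v

lemma aux_cs {g : ℝ × ℝ → ℝ} (hc : HasCompactSupport g) (v : ℝ × ℝ) :
    HasCompactSupport (fun x => fderiv ℝ g x v) :=
  hc.mono' ((subset_tsupport _).trans (aux_ts v))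

lemma aux_int1 {O : Set (ℝ × ℝ)} (hO : IsOpen O) {f g : ℝ × ℝ → ℝ}
    (hf : ContinuousOn f O) (hg : ContDiff ℝ 1 g) (hs : tsupport g ⊆ O)
    (hc : HasCompactSupport g) (v : ℝ × ℝ) :
    Integrable (fun x => f x * fderiv ℝ g x v) :=
  aux_int_mul hO hf ((hg.continuous_fderiv one_ne_zero).clm_apply continuous_const)
    ((aux_ts v).trans hs) (aux_cs hc v)

lemma aux_ibp {O : Set (ℝ × ℝ)} (hO : IsOpen O) {f g : ℝ × ℝ → ℝ}
    (hf : ContDiffOn ℝ 1 f O) (hg : ContDiff ℝ 1 g) (hs : tsupport g ⊆ O)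
    (hc : HasCompactSupport g) (v : ℝ × ℝ) :
    ∫ x, f x * fderiv ℝ g x v = - ∫ x, fderiv ℝ f x v * g x := by
  apply integral_mul_fderiv_eq_neg_fderiv_mul_of_integrable
  · exact aux_int_mul hO (aux_dcont hO hf v) hg.continuous hs hc
  · exact aux_int1 hO hf.continuousOn hg hs hc v
  · exact aux_int_mul hO hf.continuousOn hg.continuous hs hc
  · exact fun x hx => (hf.contDiffAt (hO.mem_nhds (hs hx))).differentiableAt one_ne_zero
  · exact fun x hx => hg.contDiffAt.differentiableAt one_ne_zero

lemma aux_ext {O K : Set (ℝ × ℝ)} (hO : IsOpen O) (hK : IsCompact K) (hKO : K ⊆ O)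
    {f : ℝ × ℝ → ℝ} (hf : ContDiffOn ℝ 1 f O) :
    ∃ V : ℝ × ℝ → ℝ, ContDiff ℝ 1 V ∧ HasCompactSupport V ∧ ∀ x ∈ K, V =ᶠ[nhds x] f := by
  obtain ⟨L, hL, hKL, hLO⟩ := exists_compact_between hK hO hKO
  obtain ⟨c, h1, h0, -⟩ := exists_contMDiffMap_one_nhds_of_subset_interior
    (n := 1) (modelWithCornersSelf ℝ (ℝ × ℝ)) hK.isClosed hKL
  have hts : tsupport c ⊆ L := by
    apply closure_minimal _ hL.isClosed
    intro x hx
    by_contra h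
    exact hx (h0 x h)
  refine ⟨fun x => c x * f x, ?_, ?_, ?_⟩
  · exact aux_contDiff_mul hO hf (contMDiff_iff_contDiff.mp c.contMDiff) (hts.trans hLO)
  · exact (HasCompactSupport.of_support_subset_isCompact hL ((subset_tsupport _).trans hts)).mul_right
  · intro x hx
    filter_upwards [(Filter.Eventually.filter_mono (nhds_le_nhdsSet hx) h1)] with y hy
    simp [hy]

lemma aux_cross_glob {V g : ℝ × ℝ → ℝ} (hV : ContDiff ℝ 1 V) (hVc : HasCompactSupport V)
    (hg : ContDiff ℝ 1 g) (hc : HasCompactSupport g) (v w : ℝ × ℝ) :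
    ∫ x, fderiv ℝ V x w * fderiv ℝ g x v = ∫ x, fderiv ℝ V x v * fderiv ℝ g x w := by
  obtain ⟨C, hC⟩ := hg.lipschitzWith_of_hasCompactSupport hc one_ne_zero
  obtain ⟨D, hD⟩ := hV.lipschitzWith_of_hasCompactSupport hVc one_ne_zero
  have ld : ∀ {f : ℝ × ℝ → ℝ}, ContDiff ℝ 1 f → ∀ x u, lineDeriv ℝ f x u = fderiv ℝ f x u :=
    fun hf x u => (hf.contDiffAt.differentiableAt one_ne_zero).lineDeriv_eq_fderiv
  have cV : Continuous (fun x => fderiv ℝ V x w) :=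
    (hV.continuous_fderiv one_ne_zero).clm_apply continuous_const
  have cg : Continuous (fun x => fderiv ℝ g x w) :=
    (hg.continuous_fderiv one_ne_zero).clm_apply continuous_const
  have A := hC.integral_inv_smul_sub_mul_tendsto_integral_lineDeriv_mul (μ := volume)
    (cV.integrable_of_hasCompactSupport (aux_cs hVc w)) v
  have B := hD.integral_inv_smul_sub_mul_tendsto_integral_lineDeriv_mul (μ := volume)
    (cg.integrable_of_hasCompactSupport (aux_cs hc w)) (-v)
  simp only [ld hg, ld hV] at A B
  have key : ∀ t : ℝ, ∫ x, (t⁻¹ • (g (x + t • v) - g x)) * fderiv ℝ V x w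
      = - ∫ x, (t⁻¹ • (V (x + t • (-v)) - V x)) * fderiv ℝ g x w := by
    intro t
    have hsh : HasCompactSupport (fun x => g (x + t • v)) :=
      hc.comp_homeomorph (Homeomorph.addRight (t • v))
    have hshd : ContDiff ℝ 1 (fun x => g (x + t • v)) := hg.comp (contDiff_id.add contDiff_const)
    have hVsh : HasCompactSupport (fun x => V (x + t • -v)) :=
      hVc.comp_homeomorph (Homeomorph.addRight (t • -v))
    have hVshd : ContDiff ℝ 1 (fun x => V (x + t • -v)) := hV.comp (contDiff_id.add contDiff_const)
    have e1 := aux_ibp isOpen_univ hshd.contDiffOn hV (subset_univ _) hVc w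
    have e2 := aux_ibp isOpen_univ hg.contDiffOn hV (subset_univ _) hVc w
    have e3 : ∫ x, fderiv ℝ (fun x => g (x + t • v)) x w * V x
        = ∫ x, V (x + t • (-v)) * fderiv ℝ g x w := by
      rw [← integral_add_right_eq_self _ (t • (-v))]
      congr 1; ext x
      rw [fderiv_comp_add_right]
      simp [mul_comm]
    have i1 := aux_int1 isOpen_univ hshd.continuous.continuousOn hV (subset_univ _) hVc w
    have i2 := aux_int1 isOpen_univ hg.continuous.continuousOn hV (subset_univ _) hVc w
    have i3 := aux_int1 isOpen_univ hVshd.continuous.continuousOn hg (subset_univ _) hc w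
    have i4 := aux_int1 isOpen_univ hV.continuous.continuousOn hg (subset_univ _) hc w
    have e4 : ∫ x, fderiv ℝ g x w * V x = ∫ x, V x * fderiv ℝ g x w := by
      simp_rw [mul_comm]
    simp only [smul_eq_mul, mul_assoc, integral_const_mul, sub_mul]
    rw [integral_sub i1 i2, integral_sub i3 i4, e1, e2, e3, e4]
    ring
  simp only [key] at A
  have := tendsto_nhds_unique A B.neg
  simp only [map_neg, neg_mul, integral_neg, neg_neg] at this
  rw [← this]
  simp_rw [mul_comm]

lemma aux_cross {O : Set (ℝ × ℝ)} (hO : IsOpen O) {f g : ℝ × ℝ → ℝ}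
    (hf : ContDiffOn ℝ 1 f O) (hg : ContDiff ℝ 1 g) (hs : tsupport g ⊆ O)
    (hc : HasCompactSupport g) (v w : ℝ × ℝ) :
    ∫ x, fderiv ℝ f x w * fderiv ℝ g x v = ∫ x, fderiv ℝ f x v * fderiv ℝ g x w := by
  obtain ⟨V, hV, hVc, hVe⟩ := aux_ext hO hc hs hf
  have e : ∀ v w : ℝ × ℝ, (fun x => fderiv ℝ f x w * fderiv ℝ g x v) =
      (fun x => fderiv ℝ V x w * fderiv ℝ g x v) := by
    intro v w
    ext x
    by_cases hx : x ∈ tsupport g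
    · rw [(hVe x hx).fderiv_eq]
    · have : fderiv ℝ g x v = 0 := by
        by_contra h
        exact hx (aux_ts v (subset_tsupport _ h))
      simp [this]
  rw [e, e]
  exact aux_cross_glob hV hVc hg hc v w

lemma aux_k (δ : ℝ) (hδ : 0 < δ) : ∃ k η H : ℝ → ℝ, Continuous k ∧ (∀ t, HasDerivAt η (k t) t) ∧
    (∀ t, HasDerivAt H (η t) t) ∧ (∀ t, 0 ≤ k t) ∧ (∀ t, k t ≤ 1) ∧ (∀ t, η t ^ 2 ≤ 2 * H t) ∧
    (∀ t, |t| ≤ δ → η t = 0) ∧ (∀ t, |t| ≤ δ → H t = 0) ∧ (∀ t, 2 * δ ≤ |t| → k t = 1) := by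
  let k : ℝ → ℝ := fun t => max 0 (min 1 (|t| / δ - 1))
  have hk : Continuous k := by fun_prop
  have hk0 : ∀ t, 0 ≤ k t := fun t => le_max_left _ _
  have hk1 : ∀ t, k t ≤ 1 := fun t => max_le zero_le_one (min_le_left _ _)
  let η : ℝ → ℝ := fun t => ∫ s in (0:ℝ)..t, k s
  have hη : ∀ t, HasDerivAt η (k t) t := fun t => hk.integral_hasStrictDerivAt 0 t |>.hasDerivAt
  have hηc : Continuous η := continuous_iff_continuousAt.2 fun t => (hη t).continuousAt
  let H : ℝ → ℝ := fun t => ∫ s in (0:ℝ)..t, η s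
  have hH : ∀ t, HasDerivAt H (η t) t := fun t => hηc.integral_hasStrictDerivAt 0 t |>.hasDerivAt
  have hmono : Monotone η := monotone_of_hasDerivAt_nonneg hη hk0
  have hη0 : η 0 = 0 := by simp [η]
  have hH0 : H 0 = 0 := by simp [H]
  have kz : ∀ t, |t| ≤ δ → k t = 0 := by
    intro t ht
    have : |t| / δ - 1 ≤ 0 := by
      rw [sub_nonpos, div_le_one hδ]; exact ht
    simp only [k]
    exact max_eq_left ((min_le_right _ _).trans this)
  have sub : ∀ t s : ℝ, |t| ≤ δ → s ∈ uIcc 0 t → |s| ≤ δ := by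
    intro t s ht hs
    refine le_trans ?_ ht
    simpa using abs_sub_left_of_mem_uIcc hs
  have ηz : ∀ t, |t| ≤ δ → η t = 0 := by
    intro t ht
    apply intervalIntegral.integral_zero_ae
    filter_upwards with s hs
    exact kz s (sub t s ht (uIoc_subset_uIcc hs))
  have Hz : ∀ t, |t| ≤ δ → H t = 0 := by
    intro t ht
    apply intervalIntegral.integral_zero_ae
    filter_upwards with s hs
    exact ηz s (sub t s ht (uIoc_subset_uIcc hs))
  refine ⟨k, η, H, hk, hη, hH, hk0, hk1, ?_, ηz, Hz, ?_⟩
  · have hd : ∀ t, HasDerivAt (fun t => 2 * H t - η t ^ 2) (2 * η t * (1 - k t)) t := by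
      intro t
      exact (((hH t).const_mul 2).sub ((hη t).pow 2)).congr_deriv (by push_cast; ring)
    intro t
    have hc : Continuous (fun t => 2 * H t - η t ^ 2) :=
      continuous_iff_continuousAt.2 fun t => (hd t).continuousAt
    rcases le_total 0 t with ht | ht
    · have := monotoneOn_of_hasDerivWithinAt_nonneg (convex_Ici (0:ℝ)) hc.continuousOn
        (fun x _ => (hd x).hasDerivWithinAt) (by
          intro x hx
          have : 0 ≤ η x := by rw [← hη0]; exact hmono (interior_subset hx)
          have := hk1 x
          nlinarith [mul_nonneg (hη0 ▸ hmono (interior_subset hx) : 0 ≤ η x) (sub_nonneg.2 this)])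
      have := this (self_mem_Ici) ht ht
      simp [hη0, hH0] at this
      linarith
    · have := antitoneOn_of_hasDerivWithinAt_nonpos (convex_Iic (0:ℝ)) hc.continuousOn
        (fun x _ => (hd x).hasDerivWithinAt) (by
          intro x hx
          have hx' : x ∈ Iic (0 : ℝ) := interior_subset hx
          have h1 : η x ≤ 0 := by rw [← hη0]; exact hmono hx'
          have := hk1 x
          nlinarith [mul_nonneg (neg_nonneg.2 h1) (sub_nonneg.2 this)])
      have := this ht (self_mem_Iic) ht
      simp [hη0, hH0] at this
      linarith
  · intro t ht
    have : 1 ≤ |t| / δ - 1 := by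
      rw [le_sub_iff_add_le, le_div_iff₀ hδ]; linarith
    simp [k, min_eq_left this]

lemma aux_cnt (f f' : ℝ → ℝ) (S : Set ℝ) (hf : ∀ t ∈ S, HasDerivAt f (f' t) t) :
    volume {t | t ∈ S ∧ f t = 0 ∧ f' t ≠ 0} = 0 := by
  apply Set.Countable.measure_zero
  refine (countable_setOfPred_isolated_right_within (s := {t | t ∈ S ∧ f t = 0 ∧ f' t ≠ 0})).mono ?_
  intro t ht
  refine ⟨ht, ?_⟩
  have h := (hf t ht.1).eventually_ne ht.2.2 (c := 0)
  rw [← Filter.empty_mem_iff_bot]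
  have h2 : ∀ᶠ z in nhdsWithin t ({t | t ∈ S ∧ f t = 0 ∧ f' t ≠ 0} ∩ Ioi t), f z ≠ 0 :=
    h.filter_mono (nhdsWithin_mono _ (fun z hz => (ne_of_gt hz.2)))
  filter_upwards [h2, self_mem_nhdsWithin] with z hz hz2
  exact hz hz2.1.2.1

lemma aux_null {O : Set (ℝ × ℝ)} (hO : IsOpen O) {w : ℝ × ℝ → ℝ}
    (hw : ContDiffOn ℝ 1 w O) (v : ℝ × ℝ) :
    ∀ᵐ p : ℝ × ℝ, p ∈ O → w p = 0 → fderiv ℝ w p v = 0 := by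
  let s : Set (ℝ × ℝ) := (O \ (O ∩ w ⁻¹' {0}ᶜ)) ∩ (fun p => fderiv ℝ w p v) ⁻¹' {0}ᶜ
  have hs : MeasurableSet s := by
    refine (hO.measurableSet.diff ?_).inter ?_
    · exact (hw.continuousOn.isOpen_inter_preimage hO isOpen_compl_singleton).measurableSet
    · exact (measurable_fderiv_apply_const ℝ w v) (measurableSet_singleton _).compl
  let L : ℝ →L[ℝ] ℝ × ℝ := ContinuousLinearMap.smulRight (1 : ℝ →L[ℝ] ℝ) v
  have : ∀ᵐ p : ℝ × ℝ, p ∈ sᶜ := by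
    apply ae_mem_of_ae_add_linearMap_mem L.toLinearMap volume volume hs.compl
    intro y
    have := aux_cnt (fun t => w (y + t • v)) (fun t => fderiv ℝ w (y + t • v) v)
      {t | y + t • v ∈ O} (by
        intro t ht
        have h1 : HasFDerivAt w (fderiv ℝ w (y + t • v)) (y + t • v) :=
          ((hw.contDiffAt (hO.mem_nhds ht)).differentiableAt one_ne_zero).hasFDerivAt
        have h2 : HasDerivAt (fun t : ℝ => y + t • v) v t := by
          simpa using ((hasDerivAt_id t).smul_const v).const_add y
        exact h1.comp_hasDerivAt t h2)
    rw [ae_iff]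
    refine measure_mono_null ?_ this
    intro t ht
    simp only [mem_ofPred_eq, mem_compl_iff, not_not] at ht
    have e : y + L.toLinearMap t = y + t • v := by simp [L]
    rw [e] at ht
    refine ⟨ht.1.1, ?_, ht.2⟩
    by_contra h
    exact ht.1.2 ⟨ht.1.1, h⟩
  filter_upwards [this] with p hp h1 h2
  by_contra h3
  refine hp ⟨⟨h1, ?_⟩, h3⟩
  rintro ⟨-, h4⟩
  exact h4 h2

lemma aux_ind {O K : Set (ℝ × ℝ)} (hO : IsOpen O) (hK : IsCompact K) (hKO : K ⊆ O)
    {g : ℝ × ℝ → ℝ} (hg : ContDiffOn ℝ 1 g O) (hz : ∀ p ∈ O, p ∉ K → g p = 0) :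
    ContDiff ℝ 1 (O.indicator g) ∧ tsupport (O.indicator g) ⊆ O ∧
      HasCompactSupport (O.indicator g) ∧
      ∀ p ∈ O, ∀ v, fderiv ℝ (O.indicator g) p v = fderiv ℝ g p v := by
  have hsup : Function.support (O.indicator g) ⊆ K := by
    intro p hp
    by_contra h
    apply hp
    by_cases hpO : p ∈ O
    · simp [hpO, hz p hpO h]
    · simp [hpO]
  have hts : tsupport (O.indicator g) ⊆ K := closure_minimal hsup hK.isClosed
  have he : ∀ p ∈ O, O.indicator g =ᶠ[nhds p] g := by
    intro p hp
    filter_upwards [hO.mem_nhds hp] with q hq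
    simp [hq]
  refine ⟨?_, hts.trans hKO, HasCompactSupport.of_support_subset_isCompact hK hsup, ?_⟩
  · rw [contDiff_iff_contDiffAt]
    intro x
    by_cases hx : x ∈ O
    · exact (hg.contDiffAt (hO.mem_nhds hx)).congr_of_eventuallyEq (he x hx)
    · have h1 := notMem_tsupport_iff_eventuallyEq.mp (fun h => hx (hKO (hts h)))
      exact (contDiffAt_const (c := (0:ℝ))).congr_of_eventuallyEq h1
  · intro p hp v
    rw [(he p hp).fderiv_eq]

lemma aux_main {O K : Set (ℝ × ℝ)} (hO : IsOpen O) (hK : IsCompact K) (hKO : K ⊆ O)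
    (hpos : ∀ p ∈ O, 0 < p.2) {u v ut : ℝ × ℝ → ℝ} (hu : ContDiffOn ℝ 1 u O)
    (hv : ContDiffOn ℝ 1 v O) (hut : ContDiffOn ℝ 2 ut O) (hl : ∀ p ∈ O, lap ut p = 0)
    {k η H : ℝ → ℝ} (hk : Continuous k) (hη : ∀ t, HasDerivAt η (k t) t)
    (hH : ∀ t, HasDerivAt H (η t) t)
    (hη0 : ∀ p ∈ O, p ∉ K → η (u p - ut p) = 0)
    (hH0 : ∀ p ∈ O, p ∉ K → H (u p - ut p) = 0) (γ : ℝ) :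
    ∃ Ψ : ℝ × ℝ → ℝ, IntegrableOn Ψ O ∧ ∫ p in O, Ψ p = 0 ∧ ∀ p ∈ O, Ψ p =
      (d₁ ut p - d₂ v p) * (p.2 ^ γ * (k (u p - ut p) * d₁ (fun q => u q - ut q) p)) +
      (d₂ ut p + d₁ v p) * (p.2 ^ γ * (k (u p - ut p) * d₂ (fun q => u q - ut q) p) +
        γ * p.2 ^ (γ - 1) * η (u p - ut p)) +
      γ * (p.2 ^ (γ - 1) * (η (u p - ut p) * d₂ (fun q => u q - ut q) p) +
        (γ - 1) * p.2 ^ (γ - 2) * H (u p - ut p)) := by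
  have hut1 : ContDiffOn ℝ 1 ut O := hut.of_le (by norm_num)
  have hw : ContDiffOn ℝ 1 (fun q => u q - ut q) O := hu.sub hut1
  have hηC : ContDiff ℝ 1 η := by
    rw [contDiff_one_iff_deriv]
    refine ⟨fun t => (hη t).differentiableAt, ?_⟩
    have : deriv η = k := funext fun t => (hη t).deriv
    rwa [this]
  have hHC : ContDiff ℝ 1 H := by
    rw [contDiff_one_iff_deriv]
    refine ⟨fun t => (hH t).differentiableAt, ?_⟩
    have : deriv H = η := funext fun t => (hH t).deriv
    rw [this]
    exact hηC.continuous
  have hy : ∀ c : ℝ, ContDiffOn ℝ 1 (fun p : ℝ × ℝ => p.2 ^ c) O := fun c =>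
    contDiff_snd.contDiffOn.rpow_const_of_ne (fun p hp => (hpos p hp).ne')
  have hwd : ∀ p ∈ O, HasFDerivAt (fun q => u q - ut q) (fderiv ℝ (fun q => u q - ut q) p) p :=
    fun p hp => ((hw.contDiffAt (hO.mem_nhds hp)).differentiableAt one_ne_zero).hasFDerivAt
  have hyd : ∀ c : ℝ, ∀ p ∈ O, HasFDerivAt (fun p : ℝ × ℝ => p.2 ^ c)
      ((c * p.2 ^ (c - 1)) • ContinuousLinearMap.snd ℝ ℝ ℝ) p := fun c p hp =>
    (hasFDerivAt_snd (p := p)).rpow_const (Or.inl (hpos p hp).ne')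
  obtain ⟨hφ, hφs, hφc, hφd⟩ := aux_ind hO hK hKO
    (g := fun p => p.2 ^ γ * η (u p - ut p)) ((hy γ).mul (hηC.comp_contDiffOn hw))
    (by intro p hp hpK; simp [hη0 p hp hpK])
  obtain ⟨hψ, hψs, hψc, hψd⟩ := aux_ind hO hK hKO
    (g := fun p => H (u p - ut p)) (hHC.comp_contDiffOn hw)
    (by intro p hp hpK; simp [hH0 p hp hpK])
  set φ := O.indicator (fun p => p.2 ^ γ * η (u p - ut p)) with hφdef
  set ψ := O.indicator (fun p => H (u p - ut p)) with hψdef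
  have hd1 : ContDiffOn ℝ 1 (fun q => fderiv ℝ ut q (1, 0)) O :=
    (hut.fderiv_of_isOpen hO (by norm_num)).clm_apply contDiffOn_const
  have hd2 : ContDiffOn ℝ 1 (fun q => fderiv ℝ ut q (0, 1)) O :=
    (hut.fderiv_of_isOpen hO (by norm_num)).clm_apply contDiffOn_const
  have I1 := aux_int1 hO hd1.continuousOn hφ hφs hφc (1, 0)
  have I2 := aux_int1 hO hd2.continuousOn hφ hφs hφc (0, 1)
  have I3 := aux_int1 hO (aux_dcont hO hv (0, 1)) hφ hφs hφc (1, 0)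
  have I4 := aux_int1 hO (aux_dcont hO hv (1, 0)) hφ hφs hφc (0, 1)
  have I5 := aux_int1 hO (hy (γ - 1)).continuousOn hψ hψs hψc (0, 1)
  have I6 := aux_int_mul hO (aux_dcont hO (hy (γ - 1)) (0, 1)) hψ.continuous hψs hψc
  have J1 := aux_int_mul hO (aux_dcont hO hd1 (1, 0)) hφ.continuous hφs hφc
  have J2 := aux_int_mul hO (aux_dcont hO hd2 (0, 1)) hφ.continuous hφs hφc
  have E1 := aux_ibp hO hd1 hφ hφs hφc (1, 0)
  have E2 := aux_ibp hO hd2 hφ hφs hφc (0, 1)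
  have E3 := aux_cross hO hv hφ hφs hφc (1, 0) (0, 1)
  have E5 := aux_ibp hO (hy (γ - 1)) hψ hψs hψc (0, 1)
  have E6 : (∫ x, fderiv ℝ (fun q => fderiv ℝ ut q (1, 0)) x (1, 0) * φ x) +
      ∫ x, fderiv ℝ (fun q => fderiv ℝ ut q (0, 1)) x (0, 1) * φ x = 0 := by
    rw [← integral_add J1 J2]
    apply integral_eq_zero_of_ae
    filter_upwards with x
    by_cases hx : x ∈ O
    · have := hl x hx
      simp only [lap, d₁, d₂] at this
      simp only [Pi.zero_apply]
      rw [← add_mul, this, zero_mul]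
    · simp [hφdef, hx]
  have IA := ((I1.add I2).sub I3).add I4
  have IB := (I5.add I6).const_mul γ
  have IC := IA.add IB
  refine ⟨_, IC.integrableOn, ?_, ?_⟩
  · rw [setIntegral_eq_integral_of_forall_compl_eq_zero]
    · rw [integral_add' IA IB, integral_add' ((I1.add I2).sub I3) I4,
        integral_sub' (I1.add I2) I3, integral_add' I1 I2, integral_const_mul, integral_add' I5 I6]
      rw [E1, E2, E3, E5]
      linarith
    · intro p hp
      have h1 : ∀ v, fderiv ℝ φ p v = 0 := fun v => by
        by_contra h
        exact hp (hφs (aux_ts v (subset_tsupport _ h)))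
      have h2 : ∀ v, fderiv ℝ ψ p v = 0 := fun v => by
        by_contra h
        exact hp (hψs (aux_ts v (subset_tsupport _ h)))
      have h3 : ψ p = 0 := by simp [hψdef, hp]
      simp [h1, h2, h3]
  · intro p hp
    have f1 : ∀ z, fderiv ℝ φ p z = p.2 ^ γ * (k (u p - ut p) * fderiv ℝ (fun q => u q - ut q) p z)
        + η (u p - ut p) * (γ * p.2 ^ (γ - 1) * z.2) := by
      intro z
      rw [hφd p hp]
      have := (hyd γ p hp).mul ((hη (u p - ut p)).comp_hasFDerivAt p (hwd p hp))
      refine (congrArg (fun L => L z) this.fderiv).trans ?_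
      simp
    have f2 : ∀ z, fderiv ℝ ψ p z = η (u p - ut p) * fderiv ℝ (fun q => u q - ut q) p z := by
      intro z
      rw [hψd p hp]
      have := ((hH (u p - ut p)).comp_hasFDerivAt p (hwd p hp))
      refine (congrArg (fun L => L z) this.fderiv).trans ?_
      simp
    have f3 : fderiv ℝ (fun p : ℝ × ℝ => p.2 ^ (γ - 1)) p (0, 1) = (γ - 1) * p.2 ^ (γ - 2) := by
      rw [(hyd (γ - 1) p hp).fderiv]
      simp
      left; congr 1; ring
    have f4 : ψ p = H (u p - ut p) := by simp [hψdef, hp]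
    simp only [Pi.add_apply, Pi.sub_apply, f1, f2, f3, f4, d₁, d₂]
    ring


lemma aux_pt (y Y γ k e H a b c d p q : ℝ) (hy : 0 < y) (hY : 0 ≤ Y) (hγ : 0 ≤ γ) (hγ1 : γ < 1)
    (hk0 : 0 ≤ k) (hk1 : k ≤ 1) (hH : e ^ 2 ≤ 2 * H) :
    -- a = u_x, b = v_y, c = u_y, d = v_x, p = w_x, q = w_y
    (a - p - b) * (Y * (k * p)) + (c - q + d) * (Y * (k * q) + γ * (Y / y) * e) +
      γ * ((Y / y) * (e * q) + (γ - 1) * (Y / y ^ 2) * H) ≤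
    1 / (1 - γ) * (Y * (a ^ 2 + b ^ 2 + 2 * ((c + d) / 2) ^ 2)) -
      1 / 2 * (k * (Y * (p ^ 2 + q ^ 2))) := by
  have h1 : 0 < 1 - γ := by linarith
  obtain ⟨E, hE⟩ : ∃ E, E = e / y := ⟨_, rfl⟩
  obtain ⟨H', hH'⟩ : ∃ H', H' = H / y ^ 2 := ⟨_, rfl⟩
  have hEH : E ^ 2 ≤ 2 * H' := by
    rw [hE, hH', div_pow, ← mul_div_assoc]
    gcongr
  have e1 : γ * (Y / y) * e = γ * Y * E := by rw [hE]; ring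
  have e2 : (Y / y) * (e * q) = Y * E * q := by rw [hE]; ring
  have e3 : (γ - 1) * (Y / y ^ 2) * H = (γ - 1) * Y * H' := by rw [hH']; ring
  rw [e1, e2, e3]
  have key : (a - p - b) * (k * p) + (c - q + d) * (k * q + γ * E) + γ * (E * q + (γ - 1) * H') ≤
      1 / (1 - γ) * (a ^ 2 + b ^ 2 + 2 * ((c + d) / 2) ^ 2) - 1 / 2 * (k * (p ^ 2 + q ^ 2)) := by
    obtain ⟨s, hs⟩ : ∃ s, s = a ^ 2 + b ^ 2 + 2 * ((c + d) / 2) ^ 2 := ⟨_, rfl⟩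
    rw [← hs]
    have hs0 : 0 ≤ s := by rw [hs]; positivity
    have A : (a - b) * (k * p) + (c + d) * (k * q) ≤ s + 1 / 2 * (k * (p ^ 2 + q ^ 2)) := by
      have : (a - b) * p + (c + d) * q ≤ s + 1 / 2 * (p ^ 2 + q ^ 2) := by
        rw [hs]; nlinarith [sq_nonneg (a - b - p), sq_nonneg (c + d - q), sq_nonneg (a + b)]
      linarith [mul_le_mul_of_nonneg_left this hk0, mul_le_mul_of_nonneg_right hk1 hs0]
    have B : (c + d) * E ≤ s / (1 - γ) + (1 - γ) * H' := by
      have : (c + d) ^ 2 ≤ 2 * s := by rw [hs]; nlinarith [sq_nonneg a, sq_nonneg b]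
      rw [← sub_nonneg]
      have h2 : s / (1 - γ) + (1 - γ) * H' - (c + d) * E =
        (s + (1 - γ) ^ 2 * H' - (1 - γ) * ((c + d) * E)) / (1 - γ) := by field_simp
      rw [h2]
      apply div_nonneg _ h1.le
      nlinarith [sq_nonneg ((c + d) - (1 - γ) * E), mul_le_mul_of_nonneg_left hEH (sq_nonneg (1 - γ))]
    have C : 1 / (1 - γ) * s = s + γ * (s / (1 - γ)) := by field_simp; ring
    rw [C]
    linarith [mul_le_mul_of_nonneg_left B hγ]
  linarith [mul_le_mul_of_nonneg_left key hY]

/-- **Estimate (4.31)** in the proof of Theorem 2.2 (harmonic replacement gradient bound).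
On `R = (0,h) × (0,a)`, with `γ = 2α`, `α ∈ [0,1/2)`, `𝐔 = (u,v) ∈ C¹(R̄,ℝ²) ∩ H¹(R,ℝ²)`
and `ũ` the harmonic function in `R` with `ũ = u` on `∂R`, one has
`‖y^α ∇(u - ũ)‖_{L²(R)} ≤ (4/(1-γ)) ‖y^α e(𝐔)‖_{L²(R)}`. -/
theorem harmonic_replacement_gradient_bound
    (a h : ℝ) (ha : 0 < a) (hh : 0 < h) (α : ℝ) (hα : α ∈ Set.Ico (0 : ℝ) (1 / 2))
    (U : ℝ × ℝ → ℝ × ℝ) (ut : ℝ × ℝ → ℝ)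
    -- 𝐔 ∈ C¹(R̄, ℝ²) ∩ H¹(R, ℝ²)
    (hU : ContDiffOn ℝ 1 U (closure (Set.Ioo 0 h ×ˢ Set.Ioo 0 a)))
    -- ũ is the solution of the Dirichlet problem: harmonic in R with trace u on ∂R
    (hutc : ContinuousOn ut (closure (Set.Ioo 0 h ×ˢ Set.Ioo 0 a)))
    (hutd : ContDiffOn ℝ 2 ut (Set.Ioo 0 h ×ˢ Set.Ioo 0 a))
    (hharm : ∀ p ∈ Set.Ioo 0 h ×ˢ Set.Ioo 0 a, lap ut p = 0)
    (hbd : ∀ p ∈ frontier (Set.Ioo 0 h ×ˢ Set.Ioo 0 a), ut p = (U p).1) :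
    Real.sqrt (∫ p in Set.Ioo 0 h ×ˢ Set.Ioo 0 a,
        (p.2 ^ α) ^ 2 * ((d₁ (fun q => (U q).1 - ut q) p) ^ 2 +
          (d₂ (fun q => (U q).1 - ut q) p) ^ 2)) ≤
      4 / (1 - 2 * α) *
        Real.sqrt (∫ p in Set.Ioo 0 h ×ˢ Set.Ioo 0 a,
          (p.2 ^ α) ^ 2 * strainNormSq U p) := by
  obtain ⟨hα0, hα1⟩ := hα
  set R : Set (ℝ × ℝ) := Set.Ioo 0 h ×ˢ Set.Ioo 0 a with hRdef
  have hR : IsOpen R := isOpen_Ioo.prod isOpen_Ioo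
  have hpos : ∀ p ∈ R, 0 < p.2 := fun p hp => hp.2.1
  have hcl : closure R = Icc 0 h ×ˢ Icc 0 a := by
    rw [hRdef, closure_prod_eq, closure_Ioo hh.ne, closure_Ioo ha.ne]
  have hcomp : IsCompact (closure R) := by
    rw [hcl]; exact isCompact_Icc.prod isCompact_Icc
  have huniq : UniqueDiffOn ℝ (closure R) := by
    rw [hcl]; exact (uniqueDiffOn_Icc hh).prod (uniqueDiffOn_Icc ha)
  have hu' : ContDiffOn ℝ 1 (fun q => (U q).1) (closure R) := hU.fst
  have hv' : ContDiffOn ℝ 1 (fun q => (U q).2) (closure R) := hU.snd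
  have hu := hu'.mono (subset_closure (s := R))
  have hv := hv'.mono (subset_closure (s := R))
  have hut1 : ContDiffOn ℝ 1 ut R := hutd.of_le (by norm_num)
  have hw : ContDiffOn ℝ 1 (fun q => (U q).1 - ut q) R := hu.sub hut1
  have hwc : ContinuousOn (fun q => (U q).1 - ut q) (closure R) := hu'.continuousOn.sub hutc
  have hγ1 : 0 < 1 - 2 * α := by linarith
  -- integrability of the strain
  have hS : IntegrableOn (fun p : ℝ × ℝ => (p.2 ^ α) ^ 2 * strainNormSq U p) R := by
    have c : ∀ {f : ℝ × ℝ → ℝ}, ContDiffOn ℝ 1 f (closure R) → ∀ v,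
        ContinuousOn (fun p => fderivWithin ℝ f (closure R) p v) (closure R) := fun hf v =>
      (hf.continuousOn_fderivWithin huniq le_rfl).clm_apply continuousOn_const
    have e : ∀ (f : ℝ × ℝ → ℝ), ∀ p ∈ R, fderivWithin ℝ f (closure R) p = fderiv ℝ f p :=
      fun f p hp => fderivWithin_of_mem_nhds
        (Filter.mem_of_superset (hR.mem_nhds hp) subset_closure)
    have hyc : ContinuousOn (fun p : ℝ × ℝ => p.2 ^ α) (closure R) :=
      continuous_snd.continuousOn.rpow_const (fun p _ => Or.inr hα0)
    have hcont := (hyc.pow 2).mul ((((c hu' (1, 0)).pow 2).add ((c hv' (0, 1)).pow 2)).add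
      (((((c hu' (0, 1)).add (c hv' (1, 0))).div_const 2).pow 2).const_mul 2))
    have hint := (hcont.integrableOn_compact (μ := volume) hcomp).mono_set subset_closure
    refine hint.congr_fun ?_ hR.measurableSet
    intro p hp
    simp [strainNormSq, d₁, d₂, e _ p hp]
  set G : ℝ × ℝ → ℝ := fun p => (p.2 ^ α) ^ 2 * ((d₁ (fun q => (U q).1 - ut q) p) ^ 2 +
          (d₂ (fun q => (U q).1 - ut q) p) ^ 2) with hGdef
  have hG0 : ∀ p, 0 ≤ G p := fun p => by positivity
  have hS0 : 0 ≤ ∫ p in R, (p.2 ^ α) ^ 2 * strainNormSq U p := by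
    apply integral_nonneg
    intro p
    simp only [strainNormSq, Pi.zero_apply]
    positivity
  by_cases hG : IntegrableOn G R
  swap
  · rw [integral_undef hG, Real.sqrt_zero]
    positivity
  -- bound for every cutoff
  have step : ∀ δ : ℝ, 0 < δ → ∃ k : ℝ → ℝ, Continuous k ∧ (∀ t, 0 ≤ k t) ∧ (∀ t, k t ≤ 1) ∧
      (∀ t, 2 * δ ≤ |t| → k t = 1) ∧ ∫ p in R, k ((U p).1 - ut p) * G p ≤
        2 / (1 - 2 * α) * ∫ p in R, (p.2 ^ α) ^ 2 * strainNormSq U p := by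
    intro δ hδ
    obtain ⟨k, η, H, hk, hη, hH, hk0, hk1, hηH, hη0, hH0, hk2⟩ := aux_k δ hδ
    refine ⟨k, hk, hk0, hk1, hk2, ?_⟩
    let K : Set (ℝ × ℝ) := closure R ∩ (fun q => (U q).1 - ut q) ⁻¹' {t | δ ≤ |t|}
    have hKc : IsCompact K := hcomp.of_isClosed_subset
      (hwc.preimage_isClosed_of_isClosed isClosed_closure
        (isClosed_le continuous_const continuous_abs)) inter_subset_left
    have hKR : K ⊆ R := by
      rintro p ⟨hp1, hp2⟩
      by_contra hp
      have := hbd p (by rw [hR.frontier_eq]; exact ⟨hp1, hp⟩)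
      simp only [mem_preimage, mem_ofPred_eq, this, sub_self, abs_zero] at hp2
      linarith
    have hout : ∀ p ∈ R, p ∉ K → |(U p).1 - ut p| ≤ δ := by
      intro p hp hpK
      by_contra hlt
      exact hpK ⟨subset_closure hp, (not_le.1 hlt).le⟩
    obtain ⟨Ψ, hΨ, hΨ0, hΨe⟩ := aux_main hR hKc hKR hpos hu hv hutd hharm hk hη hH
      (fun p hp hpK => hη0 _ (hout p hp hpK)) (fun p hp hpK => hH0 _ (hout p hp hpK)) (2 * α)
    have hkG : IntegrableOn (fun p => k ((U p).1 - ut p) * G p) R := by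
      refine Integrable.bdd_mul (c := 1) hG ?_ ?_
      · exact (hk.comp_continuousOn hw.continuousOn).aestronglyMeasurable hR.measurableSet
      · filter_upwards with p
        rw [Real.norm_eq_abs, abs_of_nonneg (hk0 _)]
        exact hk1 _
    have hle : ∫ p in R, Ψ p ≤ ∫ p in R, (1 / (1 - 2 * α) * ((p.2 ^ α) ^ 2 * strainNormSq U p) -
        1 / 2 * (k ((U p).1 - ut p) * G p)) := by
      refine setIntegral_mono_on hΨ ((hS.const_mul _).sub (hkG.const_mul _)) hR.measurableSet ?_
      intro p hp
      have hy := hpos p hp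
      have eY : p.2 ^ (2 * α) = (p.2 ^ α) ^ 2 := by
        rw [mul_comm, Real.rpow_mul hy.le]; norm_num
      have eY1 : p.2 ^ (2 * α - 1) = (p.2 ^ α) ^ 2 / p.2 := by
        rw [Real.rpow_sub hy, eY, Real.rpow_one]
      have eY2 : p.2 ^ (2 * α - 2) = (p.2 ^ α) ^ 2 / p.2 ^ 2 := by
        rw [Real.rpow_sub hy, eY]; norm_num
      have hdu : DifferentiableAt ℝ (fun q => (U q).1) p :=
        (hu.contDiffAt (hR.mem_nhds hp)).differentiableAt one_ne_zero
      have hdt : DifferentiableAt ℝ ut p :=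
        (hut1.contDiffAt (hR.mem_nhds hp)).differentiableAt one_ne_zero
      have ed : ∀ z, fderiv ℝ ut p z = fderiv ℝ (fun q => (U q).1) p z -
          fderiv ℝ (fun q => (U q).1 - ut q) p z := by
        intro z
        rw [fderiv_fun_sub hdu hdt]
        simp
      have e1 : d₁ ut p = d₁ (fun q => (U q).1) p - d₁ (fun q => (U q).1 - ut q) p := ed _
      have e2 : d₂ ut p = d₂ (fun q => (U q).1) p - d₂ (fun q => (U q).1 - ut q) p := ed _
      rw [hΨe p hp, e1, e2, eY, eY1, eY2]
      exact aux_pt p.2 ((p.2 ^ α) ^ 2) (2 * α) (k ((U p).1 - ut p)) (η ((U p).1 - ut p))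
        (H ((U p).1 - ut p)) _ _ _ _ _ _ hy (by positivity) (by linarith) (by linarith)
        (hk0 _) (hk1 _) (hηH _)
    rw [hΨ0, integral_sub (hS.const_mul _) (hkG.const_mul _), integral_const_mul,
      integral_const_mul] at hle
    have : 2 / (1 - 2 * α) = 2 * (1 / (1 - 2 * α)) := by ring
    rw [this]
    linarith
  have hδ : ∀ n : ℕ, (0 : ℝ) < 1 / (n + 1) := fun n => by positivity
  choose k hk hk0 hk1 hk2 hkb using fun n : ℕ => step (1 / (n + 1)) (hδ n)
  have hlim : Filter.Tendsto (fun n => ∫ p in R, k n ((U p).1 - ut p) * G p) Filter.atTop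
      (nhds (∫ p in R, G p)) := by
    apply tendsto_integral_of_dominated_convergence G
    · intro n
      exact ((hk n).comp_continuousOn hw.continuousOn).aestronglyMeasurable hR.measurableSet
        |>.mul hG.aestronglyMeasurable
    · exact hG
    · intro n
      filter_upwards with p
      rw [Real.norm_eq_abs, abs_of_nonneg (mul_nonneg (hk0 n _) (hG0 p))]
      exact mul_le_of_le_one_left (hG0 p) (hk1 n _)
    · rw [ae_restrict_iff' hR.measurableSet]
      filter_upwards [aux_null hR hw (1, 0), aux_null hR hw (0, 1)] with p h1 h2 hp
      by_cases hz : (U p).1 - ut p = 0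
      · have : G p = 0 := by
          simp only [hGdef, d₁, d₂, h1 hp hz, h2 hp hz]
          ring
        simp [this]
      · refine tendsto_const_nhds.congr' ?_
        have hpz := abs_pos.2 hz
        have ht : Filter.Tendsto (fun n : ℕ => 2 * (1 / ((n : ℝ) + 1))) Filter.atTop (nhds 0) := by
          simpa using (tendsto_one_div_add_atTop_nhds_zero_nat (𝕜 := ℝ)).const_mul 2
        filter_upwards [ht.eventually (gt_mem_nhds hpz)] with n hn
        rw [hk2 n _ hn.le, one_mul]
  have hfin := le_of_tendsto' hlim hkb
  have hc : 0 ≤ 4 / (1 - 2 * α) := by positivity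
  rw [← Real.sqrt_sq hc, ← Real.sqrt_mul (sq_nonneg _)]
  apply Real.sqrt_le_sqrt
  refine hfin.trans (mul_le_mul_of_nonneg_right ?_ hS0)
  rw [div_pow, div_le_div_iff₀ hγ1 (by positivity)]
  nlinarith
end
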